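/- arXiv:1701.02974 — 4 statements merged into one kernel-verified Lean document; each statement's English description precedes it below -/
import Mathlib

section
/- Let f and g be positive definite integral ternary quadratic forms with Gram matrices M_f and M_g, let d be a positive integer and a an integer. Suppose that for every vector v ∈ ℤ³ with v M_g vᵗ ≡ a (mod d) there exists a matrix T ∈ M₃(ℤ) such that Tᵗ M_f T = d² M_g and every entry of v Tᵗ is divisible by d (i.e., every residue class in R(g,d,a) is good with respect to f, g, d, a; in symbols g ≺_{d,a} f). Then every integer m with m ≡ a (mod d) that is represented by g over ℤ is also represented by f over ℤ. -/
open Matrix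

/-- Let `f` and `g` be positive definite integral ternary quadratic forms with
Gram matrices `Mf` and `Mg`, `d` a positive integer and `a` an integer.
If every vector `v ∈ ℤ³` with `v Mg vᵗ ≡ a (mod d)` admits `T ∈ M₃(ℤ)` with
`Tᵗ Mf T = d² Mg` and `d ∣ v Tᵗ` entrywise (i.e. `g ≺_{d,a} f`), then every
integer `m ≡ a (mod d)` represented by `g` is represented by `f`. -/
theorem rep_transfer_of_all_good (d : ℤ) (hd : 0 < d) (a : ℤ)
    (Mf Mg : Matrix (Fin 3) (Fin 3) ℤ)
    (hMf_symm : Mf.IsSymm) (hMg_symm : Mg.IsSymm)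
    (hMf_pos : ∀ v : Fin 3 → ℤ, v ≠ 0 → 0 < v ⬝ᵥ Mf.mulVec v)
    (hMg_pos : ∀ v : Fin 3 → ℤ, v ≠ 0 → 0 < v ⬝ᵥ Mg.mulVec v)
    (hgood : ∀ v : Fin 3 → ℤ, v ⬝ᵥ Mg.mulVec v ≡ a [ZMOD d] →
      ∃ T : Matrix (Fin 3) (Fin 3) ℤ,
        T.transpose * Mf * T = d ^ 2 • Mg ∧ ∀ i, d ∣ T.mulVec v i) :
    ∀ m : ℤ, m ≡ a [ZMOD d] → (∃ v : Fin 3 → ℤ, v ⬝ᵥ Mg.mulVec v = m) →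
      ∃ w : Fin 3 → ℤ, w ⬝ᵥ Mf.mulVec w = m := by
  rintro m hm ⟨v, rfl⟩
  obtain ⟨T, hT, hdvd⟩ := hgood v hm
  choose w hw using hdvd
  have hTv : T *ᵥ v = d • w := funext fun i => by simp [hw i]
  refine ⟨w, mul_left_cancel₀ (pow_ne_zero 2 hd.ne') ?_⟩
  calc d ^ 2 * (w ⬝ᵥ Mf *ᵥ w) = (T *ᵥ v) ⬝ᵥ Mf *ᵥ (T *ᵥ v) := by
        rw [hTv, mulVec_smul, smul_dotProduct, dotProduct_smul, smul_eq_mul, smul_eq_mul]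
        ring
    _ = v ⬝ᵥ (Tᵀ * Mf * T) *ᵥ v := by
        rw [← mulVec_mulVec, ← mulVec_mulVec, dotProduct_mulVec v, vecMul_transpose]
    _ = d ^ 2 * (v ⬝ᵥ Mg *ᵥ v) := by
        rw [hT, smul_mulVec, dotProduct_smul, smul_eq_mul]
end

section
/- For any positive integer n, there exist integers a, b, c such that a² + 3b² + 3c² = 24n + 7, with a ≡ b ≡ c (mod 4), and yet a ≢ b (mod 8) or a ≢ c (mod 8). -/
lemma Int.emod_eight_sq (x : ℤ) :
    (x % 2 = 1 ∧ x ^ 2 % 8 = 1) ∨ (x % 4 = 0 ∧ x ^ 2 % 8 = 0) ∨ (x % 4 = 2 ∧ x ^ 2 % 8 = 4) := by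
  have hsq : (x % 8) ^ 2 % 8 = x ^ 2 % 8 := (Int.mod_modEq x 8).pow 2
  have : x % 8 = 0 ∨ x % 8 = 1 ∨ x % 8 = 2 ∨ x % 8 = 3 ∨ x % 8 = 4 ∨ x % 8 = 5 ∨ x % 8 = 6 ∨
    x % 8 = 7 := by omega
  rcases this with h | h | h | h | h | h | h | h <;> rw [h] at hsq <;> omega

lemma Int.emod_three_sq (x : ℤ) : (x % 3 = 0 ∧ x ^ 2 % 3 = 0) ∨ (x % 3 ≠ 0 ∧ x ^ 2 % 3 = 1) := by
  have hsq : (x % 3) ^ 2 % 3 = x ^ 2 % 3 := (Int.mod_modEq x 3).pow 2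
  have : x % 3 = 0 ∨ x % 3 = 1 ∨ x % 3 = 2 := by omega
  rcases this with h | h | h <;> rw [h] at hsq <;> omega

/-- Division with remainder of smallest absolute value. -/
lemma exists_abs_two_mul_sub_le (m : ℤ) {t : ℤ} (ht : 0 < t) : ∃ k : ℤ, |m - 2 * t * k| ≤ t := by
  refine ⟨(m + t) / (2 * t), ?_⟩
  have h := Int.mul_ediv_add_emod (m + t) (2 * t)
  have h₁ := Int.emod_nonneg (m + t) (b := 2 * t) (by positivity)
  have h₂ := Int.emod_lt_of_pos (m + t) (b := 2 * t) (by positivity)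
  rw [abs_le]
  constructor <;> linarith

/-- One step of the Aubry–Davenport–Cassels descent for the form `y² + a² + ab + b²`. -/
lemma exists_smaller_denominator {M t y a b : ℤ} (ht : 1 < t)
    (h : M * t ^ 2 = y ^ 2 + a ^ 2 + a * b + b ^ 2) :
    ∃ t' y' a' b' : ℤ, 0 < t' ∧ t' < t ∧ M * t' ^ 2 = y' ^ 2 + a' ^ 2 + a' * b' + b' ^ 2 := by
  have ht0 : 0 < t := by linarith
  obtain ⟨y₀, hy⟩ := exists_abs_two_mul_sub_le (2 * y) ht0
  obtain ⟨b₀, hb⟩ := exists_abs_two_mul_sub_le (2 * b) ht0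
  obtain ⟨a₀, ha⟩ := exists_abs_two_mul_sub_le (2 * a + (b - t * b₀)) ht0
  set f₀ := y₀ ^ 2 + a₀ ^ 2 + a₀ * b₀ + b₀ ^ 2 with hf₀
  set q := 2 * y * y₀ + 2 * a * a₀ + a * b₀ + a₀ * b + 2 * b * b₀ with hq
  set s := t * f₀ + M * t - q with hs
  have key : t * s = (y - t * y₀) ^ 2 + ((a - t * a₀) ^ 2 + (a - t * a₀) * (b - t * b₀)
      + (b - t * b₀) ^ 2) := by
    rw [hs, hq, hf₀]; linear_combination h
  have hy2 := sq_le_sq' (abs_le.1 hy).1 (abs_le.1 hy).2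
  have hb2 := sq_le_sq' (abs_le.1 hb).1 (abs_le.1 hb).2
  have ha2 := sq_le_sq' (abs_le.1 ha).1 (abs_le.1 ha).2
  have key' : 16 * (t * s) = 4 * (2 * y - 2 * t * y₀) ^ 2
      + 4 * (2 * a + (b - t * b₀) - 2 * t * a₀) ^ 2 + 3 * (2 * b - 2 * t * b₀) ^ 2 := by
    rw [key]; ring
  set Y := 2 * y - 2 * t * y₀
  set A := 2 * a + (b - t * b₀) - 2 * t * a₀
  set B := 2 * b - 2 * t * b₀
  have hslt : s < t := lt_of_mul_lt_mul_left (by nlinarith) ht0.le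
  have hs0 : 0 ≤ s := nonneg_of_mul_nonneg_right
    (by linarith [sq_nonneg Y, sq_nonneg A, sq_nonneg B] : 0 ≤ t * s) ht0
  rcases hs0.eq_or_lt with h0 | hpos
  · rw [← h0, mul_zero, mul_zero] at key'
    have e₁ : Y ^ 2 = 0 := by linarith [sq_nonneg Y, sq_nonneg A, sq_nonneg B]
    have e₂ : B ^ 2 = 0 := by linarith [sq_nonneg Y, sq_nonneg A, sq_nonneg B]
    have e₃ : A ^ 2 = 0 := by linarith [sq_nonneg Y, sq_nonneg A, sq_nonneg B]
    rw [sq_eq_zero_iff] at e₁ e₂ e₃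
    have hy : y = t * y₀ := by linarith
    have hb : b = t * b₀ := by linarith
    have ha : a = t * a₀ := by linarith
    refine ⟨1, y₀, a₀, b₀, one_pos, ht, ?_⟩
    have : t ^ 2 * (M * 1 ^ 2) = t ^ 2 * (y₀ ^ 2 + a₀ ^ 2 + a₀ * b₀ + b₀ ^ 2) := by
      rw [hy, ha, hb] at h
      linear_combination h
    exact mul_left_cancel₀ (by positivity) this
  · refine ⟨s, (f₀ - M) * y + (2 * M * t - q) * y₀, (f₀ - M) * a + (2 * M * t - q) * a₀,
      (f₀ - M) * b + (2 * M * t - q) * b₀, hpos, hslt, ?_⟩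
    rw [hs, hq, hf₀]
    linear_combination (f₀ - M) ^ 2 * h

/-- The form `y² + a² + ab + b²` represents every integer it represents rationally. -/
lemma exists_integral_of_rational {M t y a b : ℤ} (ht : 0 < t)
    (h : M * t ^ 2 = y ^ 2 + a ^ 2 + a * b + b ^ 2) :
    ∃ y' a' b' : ℤ, M = y' ^ 2 + a' ^ 2 + a' * b' + b' ^ 2 := by
  induction hn : t.toNat using Nat.strong_induction_on generalizing t y a b with
  | _ n ih =>
    rcases (show 1 ≤ t from ht).eq_or_lt with rfl | ht1
    · exact ⟨y, a, b, by linarith⟩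
    · obtain ⟨t', y', a', b', hpos, hlt, h'⟩ := exists_smaller_denominator ht1 h
      exact ih t'.toNat (by omega) hpos h' rfl

lemma exists_sq_add_three_mul_sq (a b : ℤ) : ∃ r s : ℤ, a ^ 2 + a * b + b ^ 2 = r ^ 2 + 3 * s ^ 2 := by
  rcases Int.even_or_odd' a with ⟨k, rfl | rfl⟩
  · exact ⟨b + k, k, by ring⟩
  · rcases Int.even_or_odd' b with ⟨l, rfl | rfl⟩
    · exact ⟨2 * k + 1 + l, l, by ring⟩
    · exact ⟨k - l, k + l + 1, by ring⟩

/-- A pigeonhole (Thue–Legendre) argument for the form `x² - N t² + 3 p w²`. -/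
lemma exists_small_value {N p : ℕ} [Fact p.Prime] (hN3 : N % 3 = 1) (hN8 : N % 8 = 7) (hp : 3 < p)
    (hNp : N ∣ 3 * p + 1) {r : ℤ} (hr : (p : ℤ) ∣ r ^ 2 - N) :
    ∃ x t w : ℤ, ¬ (x = 0 ∧ t = 0 ∧ w = 0) ∧
      (x ^ 2 - N * t ^ 2 + 3 * p * w ^ 2 = 0 ∨
        x ^ 2 - N * t ^ 2 + 3 * p * w ^ 2 = 3 * p * N) := by
  have hpp : p.Prime := Fact.out
  have hN0 : 0 < N := by omega
  have : NeZero N := ⟨hN0.ne'⟩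
  set A := Nat.sqrt (3 * p * N) with hA
  set B := Nat.sqrt (3 * p) with hB
  set C := Nat.sqrt N with hC
  let φ : Fin (A + 1) × Fin (B + 1) × Fin (C + 1) → ZMod N × ZMod p × ZMod 3 := fun v =>
    (((v.1 : ℤ) - (v.2.2 : ℤ) : ℤ), ((v.1 : ℤ) - r * (v.2.1 : ℤ) : ℤ),
      ((v.1 : ℤ) - (v.2.1 : ℤ) : ℤ))
  have hcard : Fintype.card (ZMod N × ZMod p × ZMod 3) <
      Fintype.card (Fin (A + 1) × Fin (B + 1) × Fin (C + 1)) := by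
    simp only [Fintype.card_prod, ZMod.card, Fintype.card_fin]
    have h₁ := Nat.lt_succ_sqrt' (3 * p * N)
    have h₂ := Nat.lt_succ_sqrt' (3 * p)
    have h₃ := Nat.lt_succ_sqrt' N
    rw [← hA, Nat.succ_eq_add_one] at h₁
    rw [← hB, Nat.succ_eq_add_one] at h₂
    rw [← hC, Nat.succ_eq_add_one] at h₃
    refine lt_of_pow_lt_pow_left₀ 2 (Nat.zero_le _) ?_
    calc (N * (p * 3)) ^ 2 = (3 * p * N) * ((3 * p) * N) := by ring
      _ < (A + 1) ^ 2 * ((B + 1) ^ 2 * (C + 1) ^ 2) := by gcongr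
      _ = ((A + 1) * ((B + 1) * (C + 1))) ^ 2 := by ring
  obtain ⟨⟨x₁, t₁, w₁⟩, ⟨x₂, t₂, w₂⟩, hne, heq⟩ := Fintype.exists_ne_map_eq_of_card_lt φ hcard
  simp only [φ, Prod.mk.injEq, ZMod.intCast_eq_intCast_iff_dvd_sub] at heq
  obtain ⟨d₁, d₂, d₃⟩ := heq
  have bound {K : ℕ} (i j : Fin (Nat.sqrt K + 1)) : ((i : ℤ) - (j : ℤ)) ^ 2 ≤ K := by
    have hi : (i : ℕ) ≤ Nat.sqrt K := by omega
    have hj : (j : ℕ) ≤ Nat.sqrt K := by omega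
    have hK : ((Nat.sqrt K : ℕ) : ℤ) ^ 2 ≤ K := by exact_mod_cast Nat.sqrt_le' K
    zify at hi hj
    refine le_trans (sq_le_sq' ?_ ?_) hK <;> linarith [Int.natCast_nonneg i, Int.natCast_nonneg j]
  set x : ℤ := (x₂ : ℤ) - (x₁ : ℤ) with hx
  set t : ℤ := (t₂ : ℤ) - (t₁ : ℤ) with ht
  set w : ℤ := (w₂ : ℤ) - (w₁ : ℤ) with hw
  have hx2 : x ^ 2 ≤ 3 * p * N := by simpa using bound x₂ x₁
  have ht2 : t ^ 2 ≤ 3 * p := by simpa using bound t₂ t₁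
  have hw2 : w ^ 2 ≤ N := by simpa using bound w₂ w₁
  have ht2' : t ^ 2 < 3 * p := by
    refine lt_of_le_of_ne ht2 fun h => ?_
    have hpt : (p : ℤ) ∣ t := (Nat.prime_iff_prime_int.1 hpp).dvd_of_dvd_pow (h ▸ dvd_mul_left _ _)
    obtain ⟨c, hc⟩ := hpt
    have hp0 : (p : ℤ) ≠ 0 := by exact_mod_cast hpp.ne_zero
    have : (p : ℤ) * c ^ 2 = 3 := mul_left_cancel₀ hp0 (by rw [hc] at h; linear_combination h)
    have := Int.le_of_dvd (by norm_num) (Dvd.intro _ this)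
    omega
  have hw2' : w ^ 2 < N := by
    refine lt_of_le_of_ne hw2 fun h => ?_
    have hw8 := Int.emod_eight_sq w
    omega
  set V := x ^ 2 - N * t ^ 2 + 3 * p * w ^ 2 with hV
  have e₁ : (N : ℤ) ∣ x - w := by convert d₁ using 1; ring
  have e₂ : (p : ℤ) ∣ x - r * t := by convert d₂ using 1; rw [hx, ht]; ring
  have e₃ : (3 : ℤ) ∣ x - t := by
    have : x - t = ((x₂ : ℤ) - (t₂ : ℤ)) - ((x₁ : ℤ) - (t₁ : ℤ)) := by ring
    rw [this]; exact_mod_cast d₃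
  have V₁ : (N : ℤ) ∣ V := by
    obtain ⟨c, hc⟩ := e₁
    obtain ⟨k, hk⟩ := hNp
    zify at hk
    exact ⟨c * (x + w) - t ^ 2 + k * w ^ 2, by
      rw [hV]; linear_combination (x + w) * hc + w ^ 2 * hk⟩
  have V₂ : (p : ℤ) ∣ V := by
    obtain ⟨c, hc⟩ := e₂
    obtain ⟨k, hk⟩ := hr
    exact ⟨c * (x + r * t) + k * t ^ 2 + 3 * w ^ 2, by
      rw [hV]; linear_combination (x + r * t) * hc + t ^ 2 * hk⟩
  have V₃ : (3 : ℤ) ∣ V := by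
    obtain ⟨c, hc⟩ := e₃
    obtain ⟨k, hk⟩ : (3 : ℤ) ∣ 1 - N := by omega
    exact ⟨c * (x + t) + k * t ^ 2 + p * w ^ 2, by
      rw [hV]; linear_combination (x + t) * hc + t ^ 2 * hk⟩
  have c₃p : IsCoprime (3 : ℤ) p := by
    have : Nat.Coprime 3 p := (Nat.coprime_primes Nat.prime_three hpp).2 (by omega)
    exact_mod_cast Nat.isCoprime_iff_coprime.2 this
  have c₃pN : IsCoprime (3 * p : ℤ) N := by
    obtain ⟨k, hk⟩ := hNp
    zify at hk
    exact ⟨-1, k, by linear_combination -hk⟩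
  obtain ⟨k, hk⟩ := c₃pN.mul_dvd (c₃p.mul_dvd V₃ V₂) V₁
  have hP : (0 : ℤ) < 3 * p * N := by
    have := hpp.pos
    positivity
  have hNpos : (0 : ℤ) < N := by exact_mod_cast hN0
  have hppos : (0 : ℤ) < p := by exact_mod_cast hpp.pos
  have lo : -(3 * p * N : ℤ) < V := by
    rw [hV]; nlinarith [sq_nonneg x, sq_nonneg w, mul_lt_mul_of_pos_left ht2' hNpos]
  have hi : V < 2 * (3 * p * N : ℤ) := by
    rw [hV]
    nlinarith [sq_nonneg t, mul_lt_mul_of_pos_left hw2' hppos]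
  have k₁ : -1 < k := lt_of_mul_lt_mul_left (by linarith) hP.le
  have k₂ : k < 2 := lt_of_mul_lt_mul_left (by linarith) hP.le
  refine ⟨x, t, w, ?_, ?_⟩
  · rintro ⟨h₁, h₂, h₃⟩
    apply hne
    simp only [Prod.mk.injEq, Fin.ext_iff]
    omega
  · obtain rfl | rfl : k = 0 ∨ k = 1 := by omega
    · left; rw [← hV, hk, mul_zero]
    · right; rw [← hV, hk, mul_one]

/-- Legendre's theorem for `N t² = x² + 3 p w²` in the case at hand. -/
lemma exists_eq_sq_add_three_mul_prime {N p : ℕ} [Fact p.Prime] (hN3 : N % 3 = 1) (hN8 : N % 8 = 7)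
    (hp : 3 < p) (hNp : N ∣ 3 * p + 1) {r : ℤ} (hr : (p : ℤ) ∣ r ^ 2 - N) :
    ∃ t x w : ℤ, t ≠ 0 ∧ N * t ^ 2 = x ^ 2 + 3 * p * w ^ 2 := by
  obtain ⟨x, t, w, hne, h | h⟩ := exists_small_value hN3 hN8 hp hNp hr
  · refine ⟨t, x, w, ?_, by linarith⟩
    rintro rfl
    have hpp : (0 : ℤ) < p := by exact_mod_cast (by omega : 0 < p)
    have hw : w = 0 := by
      by_contra hw
      have : 0 < w ^ 2 := by positivity
      nlinarith [sq_nonneg x, mul_pos hpp this]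
    subst hw
    exact hne ⟨by simpa using h, rfl, rfl⟩
  · have hW : w ^ 2 - N ≠ 0 := by
      intro h0
      have hw8 := Int.emod_eight_sq w
      omega
    have heq : N * (x + t * w) ^ 2 = (x * w + N * t) ^ 2 + 3 * p * (w ^ 2 - N) ^ 2 := by
      linear_combination (-(w ^ 2) + N) * h
    refine ⟨x + t * w, x * w + N * t, w ^ 2 - N, fun h0 => ?_, heq⟩
    have hpp : (0 : ℤ) < p := by exact_mod_cast (by omega : 0 < p)
    have : 0 < (w ^ 2 - N : ℤ) ^ 2 := by positivity
    rw [h0] at heq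
    nlinarith [sq_nonneg (x * w + N * t), mul_pos hpp this]

open NumberTheorySymbols in
lemma exists_rational_rep (n : ℕ) :
    ∃ t x y z : ℤ, t ≠ 0 ∧ (24 * n + 7) * t ^ 2 = x ^ 2 + 3 * y ^ 2 + 3 * z ^ 2 := by
  have hcop : (32 * n + 9).Coprime (4 * (24 * n + 7)) := by
    rw [← Nat.isCoprime_iff_coprime]
    exact ⟨-3, 1, by push_cast; ring⟩
  obtain ⟨p, hp3, hpp, hmod⟩ := Nat.forall_exists_prime_gt_and_modEq 3 (by omega) hcop
  have : Fact p.Prime := ⟨hpp⟩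
  have hp4 : p % 4 = 1 := by
    have h : p % 4 = (32 * n + 9) % 4 := hmod.of_mul_right _
    omega
  have hdvd : 24 * n + 7 ∣ 3 * p + 1 := by
    have h : 3 * p + 1 ≡ 3 * (32 * n + 9) + 1 [MOD 24 * n + 7] :=
      ((hmod.of_mul_left 4).mul_left 3).add_right 1
    refine (h.dvd_iff dvd_rfl).2 ⟨4, by ring⟩
  set N := 24 * n + 7 with hN
  have hodd : Odd N := ⟨12 * n + 3, by omega⟩
  have J₃ : J(3 | N) = -1 := by
    have h := jacobiSym.quadratic_reciprocity_three_mod_four (a := 3) (b := N) (by norm_num)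
      (by omega)
    have h1 : J((N : ℤ) | 3) = 1 := by
      rw [jacobiSym.mod_left, show (N : ℤ) % (3 : ℕ) = 1 by omega, jacobiSym.one_left]
    rw [h1] at h
    exact_mod_cast h
  have J₁ : J(-1 | N) = -1 := by
    rw [jacobiSym.at_neg_one hodd, ZMod.χ₄_nat_three_mod_four (by omega)]
  have Jp : J((p : ℤ) | N) = 1 := by
    have h : J(-1 * 3 * (p : ℤ) | N) = 1 := by
      rw [jacobiSym.mod_left' (a₂ := 1), jacobiSym.one_left]
      refine Int.modEq_iff_dvd.2 ?_
      obtain ⟨k, hk⟩ := hdvd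
      zify at hk
      exact ⟨k, by linear_combination hk⟩
    rw [jacobiSym.mul_left, jacobiSym.mul_left, J₁, J₃] at h
    simpa using h
  rw [jacobiSym.quadratic_reciprocity_one_mod_four hp4 hodd] at Jp
  obtain ⟨r, hr⟩ := ZMod.isSquare_of_jacobiSym_eq_one Jp
  obtain ⟨r, rfl⟩ := ZMod.intCast_surjective r
  have hr' : (p : ℤ) ∣ r ^ 2 - N := by
    rw [← ZMod.intCast_eq_intCast_iff_dvd_sub, hr]
    push_cast
    ring
  obtain ⟨t, x, w, ht, h⟩ := exists_eq_sq_add_three_mul_prime (N := N) (p := p) (by omega) (by omega)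
    hp3 hdvd hr'
  obtain ⟨u, v, huv⟩ := Nat.Prime.sq_add_sq (p := p) (by omega)
  zify at huv
  refine ⟨t, x, u * w, v * w, ht, ?_⟩
  rw [hN] at h
  push_cast at h
  rw [h, ← huv]
  ring

/-- If `s² + 3z² ≡ 4 (mod 8)`, then `s² + 3z²` is also a value at odd arguments. -/
lemma exists_odd_sq_add_three_mul_sq {s z : ℤ} (h : (s ^ 2 + 3 * z ^ 2) % 8 = 4) :
    ∃ s' z' : ℤ, s' % 2 = 1 ∧ z' % 2 = 1 ∧ s' ^ 2 + 3 * z' ^ 2 = s ^ 2 + 3 * z ^ 2 := by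
  have hs := Int.emod_eight_sq s
  have hz := Int.emod_eight_sq z
  by_cases hodd : s % 2 = 1
  · exact ⟨s, z, hodd, by omega, rfl⟩
  · obtain ⟨k, rfl⟩ : (2 : ℤ) ∣ s := by omega
    obtain ⟨l, rfl⟩ : (2 : ℤ) ∣ z := by omega
    exact ⟨k - 3 * l, k + l, by omega, by omega, by ring⟩

/-- Every `24n + 7` is of the form `x² + 3y² + 3z²` with `x, y, z` odd. -/
lemma exists_odd_rep (n : ℕ) :
    ∃ x y z : ℤ, x % 2 = 1 ∧ y % 2 = 1 ∧ z % 2 = 1 ∧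
      x ^ 2 + 3 * y ^ 2 + 3 * z ^ 2 = 24 * n + 7 := by
  obtain ⟨t, x, y, z, ht, h⟩ := exists_rational_rep n
  obtain ⟨Y, a, b, hM⟩ := exists_integral_of_rational (M := 3 * (24 * n + 7)) (t := |t|)
    (y := 3 * y) (a := 3 * z - x) (b := 2 * x) (abs_pos.2 ht)
    (by rw [sq_abs]; linear_combination 3 * h)
  obtain ⟨R, s, hrs⟩ := exists_sq_add_three_mul_sq a b
  have h3 : Y ^ 2 + R ^ 2 = 3 * (24 * n + 7 - s ^ 2) := by linear_combination -hM - hrs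
  have hdiv : Y % 3 = 0 ∧ R % 3 = 0 := by
    have hm : (Y ^ 2 + R ^ 2) % 3 = 0 := by omega
    have hY := Int.emod_three_sq Y
    have hR := Int.emod_three_sq R
    omega
  obtain ⟨v, rfl⟩ : (3 : ℤ) ∣ Y := by omega
  obtain ⟨u, rfl⟩ : (3 : ℤ) ∣ R := by omega
  have hrep : s ^ 2 + 3 * v ^ 2 + 3 * u ^ 2 = 24 * n + 7 := by linarith
  have hs := Int.emod_eight_sq s
  have hv := Int.emod_eight_sq v
  have hu := Int.emod_eight_sq u
  by_cases hvo : v % 2 = 1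
  · obtain ⟨s', u', h₁, h₂, h₃⟩ := exists_odd_sq_add_three_mul_sq (s := s) (z := u) (by omega)
    exact ⟨s', v, u', h₁, hvo, h₂, by linarith⟩
  · have huo : u % 2 = 1 := by omega
    obtain ⟨s', v', h₁, h₂, h₃⟩ := exists_odd_sq_add_three_mul_sq (s := s) (z := v) (by omega)
    exact ⟨s', v', u, h₁, h₂, huo, by linarith⟩

/-- The integer `m` has a representation by `x² + 3y² + 3z²` at odd arguments whose squares are
not all equal. -/
def HasNonconstantOddRep (m : ℤ) : Prop :=
  ∃ x y z : ℤ, x % 2 = 1 ∧ y % 2 = 1 ∧ z % 2 = 1 ∧ x ^ 2 + 3 * y ^ 2 + 3 * z ^ 2 = m ∧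
    ¬ (x ^ 2 = y ^ 2 ∧ x ^ 2 = z ^ 2)

lemma HasNonconstantOddRep.mul_sq {m k : ℤ} (h : HasNonconstantOddRep m) (hk : k % 2 = 1) :
    HasNonconstantOddRep (m * k ^ 2) := by
  obtain ⟨x, y, z, hx, hy, hz, hm, hne⟩ := h
  have hk0 : k ^ 2 ≠ 0 := by
    have : k ≠ 0 := by omega
    positivity
  refine ⟨x * k, y * k, z * k, by simp [Int.mul_emod, hx, hk], by simp [Int.mul_emod, hy, hk],
    by simp [Int.mul_emod, hz, hk], by rw [← hm]; ring, ?_⟩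
  simpa only [mul_pow, mul_left_inj' hk0] using hne

/-- Conjugation of `-i + j + k` by `a + bi + cj + dk` in the quaternion algebra with `i² = -1`,
`j² = k² = -3`. -/
lemma hasNonconstantOddRep_of_quaternion {a b c d : ℤ} (ha : a % 2 = 0) (hb : b % 2 = 1)
    (hc : c % 2 = 1) (hd : d % 2 = 1) (hb3 : ¬ (3 : ℤ) ∣ b) (hb0 : 0 < b) (hc0 : 0 < c)
    (hd0 : 0 < d) : HasNonconstantOddRep (7 * (a ^ 2 + b ^ 2 + 3 * c ^ 2 + 3 * d ^ 2) ^ 2) := by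
  have ha2 := Int.emod_eight_sq a
  have hb2 := Int.emod_eight_sq b
  have hc2 := Int.emod_eight_sq c
  have hd2 := Int.emod_eight_sq d
  set s := a ^ 2 + b ^ 2 + 3 * c ^ 2 + 3 * d ^ 2 with hs
  have hs0 : 0 < s := by positivity
  obtain ⟨X, hX⟩ : ∃ X, X = -a ^ 2 - b ^ 2 + 3 * c ^ 2 + 3 * d ^ 2
      + 2 * (3 * (b * c) + 3 * (b * d) + 3 * (a * c) - 3 * (a * d)) := ⟨_, rfl⟩
  obtain ⟨Y, hY⟩ : ∃ Y, Y = a ^ 2 - b ^ 2 + 3 * c ^ 2 - 3 * d ^ 2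
      + 2 * (-(b * c) + 3 * (c * d) - a * d - a * b) := ⟨_, rfl⟩
  obtain ⟨Z, hZ⟩ : ∃ Z, Z = a ^ 2 - b ^ 2 - 3 * c ^ 2 + 3 * d ^ 2
      + 2 * (-(b * d) + 3 * (c * d) + a * b + a * c) := ⟨_, rfl⟩
  have hnorm : X ^ 2 + 3 * Y ^ 2 + 3 * Z ^ 2 = 7 * s ^ 2 := by rw [hX, hY, hZ, hs]; ring
  have haxis : b * X + 3 * c * Y + 3 * d * Z = s * (-b + 3 * c + 3 * d) := by
    rw [hX, hY, hZ, hs]; ring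
  have hinner : -X + 3 * Y + 3 * Z
      = 7 * s - 2 * (3 * (b + c) ^ 2 + 3 * (b + d) ^ 2 + 9 * (c - d) ^ 2) := by
    rw [hX, hY, hZ, hs]; ring
  refine ⟨X, Y, Z, by omega, by omega, by omega, hnorm, ?_⟩
  rintro ⟨hXY, hXZ⟩
  have hXs : X ^ 2 = s ^ 2 := by linarith
  have hX' := sq_eq_sq_iff_eq_or_eq_neg.1 hXs
  have hY' := sq_eq_sq_iff_eq_or_eq_neg.1 (hXY.symm.trans hXs)
  have hZ' := sq_eq_sq_iff_eq_or_eq_neg.1 (hXZ.symm.trans hXs)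
  have cancel {e : ℤ} (h : s * e = s * (-b + 3 * c + 3 * d)) : e = -b + 3 * c + 3 * d :=
    mul_left_cancel₀ hs0.ne' h
  rcases hX' with hX' | hX' <;> rcases hY' with hY' | hY' <;> rcases hZ' with hZ' | hZ' <;>
    rw [hX', hY', hZ'] at haxis
  · have := cancel (e := b + 3 * c + 3 * d) (by rw [← haxis]; ring)
    omega
  · have := cancel (e := b + 3 * c - 3 * d) (by rw [← haxis]; ring)
    omega
  · have := cancel (e := b - 3 * c + 3 * d) (by rw [← haxis]; ring)
    omega
  · have := cancel (e := b - 3 * c - 3 * d) (by rw [← haxis]; ring)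
    omega
  · rw [hX', hY', hZ'] at hinner
    have : 0 < (b + c) ^ 2 := by positivity
    linarith [sq_nonneg (b + d), sq_nonneg (c - d)]
  · have := cancel (e := -b + 3 * c - 3 * d) (by rw [← haxis]; ring)
    omega
  · have := cancel (e := -b - 3 * c + 3 * d) (by rw [← haxis]; ring)
    omega
  · have := cancel (e := -b - 3 * c - 3 * d) (by rw [← haxis]; ring)
    omega

lemma hasNonconstantOddRep_of_three_mod_four {p : ℕ} (hp4 : p % 4 = 3) (hp3 : p % 3 ≠ 0) :
    HasNonconstantOddRep (7 * (p : ℤ) ^ 2) := by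
  by_cases h19 : p = 19
  · subst h19
    exact ⟨11, 21, 19, by norm_num, by norm_num, by norm_num, by norm_num, by norm_num⟩
  obtain ⟨a, n, ha, hp⟩ : ∃ a n : ℕ, a % 2 = 0 ∧ p = a ^ 2 + (24 * n + 7) := by
    have : p % 24 = 7 ∨ p % 24 = 11 ∨ p % 24 = 19 ∨ p % 24 = 23 := by omega
    rcases this with h | h | h | h
    · exact ⟨0, (p - 7) / 24, by norm_num, by omega⟩
    · exact ⟨2, (p - 11) / 24, by norm_num, by omega⟩
    · exact ⟨6, (p - 43) / 24, by norm_num, by omega⟩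
    · exact ⟨4, (p - 23) / 24, by norm_num, by omega⟩
  obtain ⟨b, c, d, hb, hc, hd, h⟩ := exists_odd_rep n
  have hb3 := Int.emod_three_sq b
  have := hasNonconstantOddRep_of_quaternion (a := a) (b := |b|) (c := |c|) (d := |d|) (by omega)
    (by grind) (by grind) (by grind) (by rw [dvd_abs]; omega) (by grind) (by grind) (by grind)
  rw [sq_abs, sq_abs, sq_abs] at this
  convert this using 3
  rw [hp]
  push_cast
  linarith

lemma hasNonconstantOddRep_of_prime_one_mod_four {p : ℕ} [Fact p.Prime] (hp4 : p % 4 = 1) :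
    HasNonconstantOddRep (7 * (p : ℤ) ^ 2) := by
  obtain ⟨u, v, huv⟩ := Nat.Prime.sq_add_sq (p := p) (by omega)
  zify at huv
  have hu := Int.emod_eight_sq u
  have hv := Int.emod_eight_sq v
  have hprime : Prime (p : ℤ) := Nat.prime_iff_prime_int.1 Fact.out
  refine ⟨p, u ^ 2 - v ^ 2 + 2 * (u * v), u ^ 2 - v ^ 2 - 2 * (u * v), by omega, by omega, by omega,
    by rw [← huv]; ring, ?_⟩
  rintro ⟨h, -⟩
  have h0 : (u * v : ℤ) * (u ^ 2 - v ^ 2) = 0 := by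
    rw [← huv] at h
    linarith
  have hdiff : (u ^ 2 - v ^ 2 : ℤ) ≠ 0 := by omega
  have nsq (w : ℤ) : w ^ 2 ≠ p := fun hw => hprime.not_isSquare ⟨w, by rw [← hw, sq]⟩
  rcases mul_eq_zero.1 ((mul_eq_zero.1 h0).resolve_right hdiff) with h | h
  · exact nsq v (by rw [← huv, h]; ring)
  · exact nsq u (by rw [← huv, h]; ring)

lemma hasNonconstantOddRep {n : ℕ} (hn : 0 < n) : HasNonconstantOddRep (24 * n + 7) := by
  obtain ⟨x, y, z, hx, hy, hz, h⟩ := exists_odd_rep n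
  by_cases hne : x ^ 2 = y ^ 2 ∧ x ^ 2 = z ^ 2
  · have h7 : 7 * x ^ 2 = 24 * n + 7 := by
      rw [← h, ← hne.1, ← hne.2]; ring
    have hx1 : x.natAbs ≠ 1 := by
      intro h1
      have : x ^ 2 = 1 := by rw [← Int.natAbs_sq, h1]; norm_num
      omega
    have hpp := Nat.minFac_prime hx1
    set p := x.natAbs.minFac
    have : Fact p.Prime := ⟨hpp⟩
    obtain ⟨k, hk⟩ : (p : ℤ) ∣ x := Int.natCast_dvd.2 (Nat.minFac_dvd _)
    have hp2 : p % 2 = 1 ∧ k % 2 = 1 := by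
      have : Odd ((p : ℤ) * k) := by rw [← hk]; exact Int.odd_iff.2 hx
      have := Int.odd_mul.1 this
      rw [Int.odd_iff, Int.odd_iff] at this
      omega
    have hp3 : p % 3 ≠ 0 := by
      intro h3
      obtain ⟨l, hl⟩ := Nat.dvd_of_mod_eq_zero h3
      rw [hk, hl] at h7
      push_cast at h7
      ring_nf at h7
      omega
    have key : HasNonconstantOddRep (7 * (p : ℤ) ^ 2) := by
      have : p % 4 = 1 ∨ p % 4 = 3 := by omega
      rcases this with h1 | h1
      · exact hasNonconstantOddRep_of_prime_one_mod_four h1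
      · exact hasNonconstantOddRep_of_three_mod_four h1 hp3
    have := key.mul_sq hp2.2
    rwa [mul_assoc, ← mul_pow, ← hk, h7] at this
  · exact ⟨x, y, z, hx, hy, hz, h, hne⟩

lemma exists_sq_eq_sq_modEq_one {x : ℤ} (hx : x % 2 = 1) : ∃ y : ℤ, y ^ 2 = x ^ 2 ∧ y % 4 = 1 := by
  have : x % 4 = 1 ∨ x % 4 = 3 := by omega
  rcases this with h | h
  · exact ⟨x, rfl, h⟩
  · exact ⟨-x, by ring, by omega⟩

/-- If congruence modulo `4` of the three arguments always forces congruence modulo `8`, then it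
forces congruence modulo every power of `2`. -/
lemma two_pow_dvd_sub {m : ℤ}
    (H : ∀ a b c : ℤ, a ^ 2 + 3 * b ^ 2 + 3 * c ^ 2 = m → 4 ∣ a - b → 4 ∣ a - c →
      8 ∣ a - b ∧ 8 ∣ a - c) (j : ℕ) {a b c : ℤ} (h : a ^ 2 + 3 * b ^ 2 + 3 * c ^ 2 = m)
    (hab : 4 ∣ a - b) (hac : 4 ∣ a - c) : 2 ^ j ∣ a - b ∧ 2 ^ j ∣ a - c := by
  induction j generalizing a b c with
  | zero => simp
  | succ j ih =>
    have step {a b c : ℤ} (h : a ^ 2 + 3 * b ^ 2 + 3 * c ^ 2 = m) (hab : 4 ∣ a - b)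
        (hac : 4 ∣ a - c) : 2 ^ (j + 1) ∣ a - b := by
      obtain ⟨k, hk⟩ := (H a b c h hab hac).1
      obtain rfl : b = a - 8 * k := by linarith
      have h' : (a - 12 * k) ^ 2 + 3 * (a - 4 * k) ^ 2 + 3 * c ^ 2 = m := by rw [← h]; ring
      have h₁ := (ih h' (by omega) (by omega)).2
      have h₂ := (ih h hab hac).2
      have h₃ : (2 : ℤ) ^ j ∣ 3 * (4 * k) := by
        exact (dvd_sub h₂ h₁).trans (dvd_of_eq (by ring))
      have h₄ : (2 : ℤ) ^ j ∣ 4 * k :=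
        (IsCoprime.pow_left (by norm_num : IsCoprime (2 : ℤ) 3)).dvd_of_dvd_mul_left h₃
      rw [pow_succ']
      exact (mul_dvd_mul_left 2 h₄).trans (dvd_of_eq (by ring))
    exact ⟨step h hab hac, step (by linarith) hac hab⟩

lemma eq_of_forall_two_pow_dvd_sub {a b : ℤ} (h : ∀ j : ℕ, 2 ^ j ∣ a - b) : a = b := by
  by_contra hne
  have h₁ := Int.natAbs_dvd_natAbs.2 (h (a - b).natAbs)
  rw [Int.natAbs_pow] at h₁
  exact absurd (Nat.le_of_dvd (by omega) h₁) (not_le.2 Nat.lt_two_pow_self)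

/-- For any positive integer `n`, there exist integers `a, b, c` such that
`a² + 3b² + 3c² = 24n + 7`, with `a ≡ b ≡ c (mod 4)`, and yet
`a ≢ b (mod 8)` or `a ≢ c (mod 8)`. -/
theorem exists_rep_with_congruence_conditions (n : ℤ) (hn : 0 < n) :
    ∃ a b c : ℤ, a ^ 2 + 3 * b ^ 2 + 3 * c ^ 2 = 24 * n + 7 ∧
      a ≡ b [ZMOD 4] ∧ b ≡ c [ZMOD 4] ∧
      (¬ a ≡ b [ZMOD 8] ∨ ¬ a ≡ c [ZMOD 8]) := by
  lift n to ℕ using hn.le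
  by_contra! hcon
  have H : ∀ a b c : ℤ, a ^ 2 + 3 * b ^ 2 + 3 * c ^ 2 = 24 * n + 7 → 4 ∣ a - b → 4 ∣ a - c →
      8 ∣ a - b ∧ 8 ∣ a - c := by
    intro a b c h hab hac
    have h8 := hcon a b c h (by unfold Int.ModEq; omega) (by unfold Int.ModEq; omega)
    unfold Int.ModEq at h8
    omega
  obtain ⟨x, y, z, hx, hy, hz, h, hne⟩ := hasNonconstantOddRep (by exact_mod_cast hn)
  obtain ⟨a, ha, ha4⟩ := exists_sq_eq_sq_modEq_one hx
  obtain ⟨b, hb, hb4⟩ := exists_sq_eq_sq_modEq_one hy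
  obtain ⟨c, hc, hc4⟩ := exists_sq_eq_sq_modEq_one hz
  rw [← ha, ← hb, ← hc] at h hne
  have hdvd (j : ℕ) := two_pow_dvd_sub H j h (by omega) (by omega)
  obtain rfl := eq_of_forall_two_pow_dvd_sub fun j => (hdvd j).1
  obtain rfl := eq_of_forall_two_pow_dvd_sub fun j => (hdvd j).2
  exact hne ⟨rfl, rfl⟩
end

section
/- The ternary sum x(2x+1) + y(2y+1) + z(6z+1) is universal; that is, for every non negative integer n, the equation x(2x+1) + y(2y+1) + z(6z+1) = n has an integer solution x, y, z. -/
open NumberTheorySymbols in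
theorem jacobiSym_neg_of_mod_four_eq_three {a b : ℕ} (ha : a % 4 = 3) (hb : Odd b) :
    J(-(a : ℤ) | b) = J(b | a) := by
  have ha' : Odd a := Nat.odd_iff.2 (by omega)
  rw [jacobiSym.neg _ hb]
  rcases Nat.odd_mod_four_iff.1 (Nat.odd_iff.1 hb) with h | h
  · rw [ZMod.χ₄_nat_one_mod_four h, one_mul, jacobiSym.quadratic_reciprocity_one_mod_four' ha' h]
  · rw [ZMod.χ₄_nat_three_mod_four h, jacobiSym.quadratic_reciprocity_three_mod_four ha h]
    ring

open NumberTheorySymbols in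
theorem jacobiSym_neg_three {b : ℕ} (hb : Odd b) (h : b % 3 = 1) : J(-3 | b) = 1 := by
  have := jacobiSym_neg_of_mod_four_eq_three (a := 3) rfl hb
  rw [Nat.cast_ofNat] at this
  rw [this, jacobiSym.mod_left' (a₂ := 1) (by omega), jacobiSym.one_left]

open NumberTheorySymbols in
theorem exists_sq_add_eq_mul_of_jacobiSym {p : ℕ} (hp : p.Prime) {a : ℤ} (h : J(-a | p) = 1) :
    ∃ b k : ℤ, b ^ 2 + a = p * k := by
  have : Fact p.Prime := ⟨hp⟩
  rw [← jacobiSym.legendreSym.to_jacobiSym] at h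
  have h0 : ((-a : ℤ) : ZMod p) ≠ 0 := by
    intro h0
    rw [(legendreSym.eq_zero_iff p _).2 h0] at h
    exact zero_ne_one h
  obtain ⟨r, hr⟩ := (legendreSym.eq_one_iff p h0).1 h
  obtain ⟨b, rfl⟩ := ZMod.intCast_surjective r
  have : ((b ^ 2 + a : ℤ) : ZMod p) = 0 := by
    push_cast at hr ⊢
    rw [sq, ← hr, neg_add_cancel]
  obtain ⟨k, hk⟩ := (ZMod.intCast_zmod_eq_zero_iff_dvd _ p).1 this
  exact ⟨b, k, hk⟩

theorem exists_abs_two_mul_add_mul_le {a : ℤ} (ha : 0 < a) (b : ℤ) :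
    ∃ k : ℤ, |2 * (b + k * a)| ≤ a := by
  refine ⟨-((2 * b + a) / (2 * a)), ?_⟩
  have h₁ := Int.mul_ediv_add_emod (2 * b + a) (2 * a)
  have h₂ := Int.emod_nonneg (2 * b + a) (b := 2 * a) (by omega)
  have h₃ := Int.emod_lt_of_pos (2 * b + a) (b := 2 * a) (by omega)
  rw [abs_le]
  constructor <;> linarith

/-- The positive definite integral form `a X² + 2 b X Y + c Y²` has determinant `3` and
represents `N`. -/
def BinaryRep (N a b c : ℤ) : Prop :=
  0 < a ∧ a * c - b ^ 2 = 3 ∧ ∃ x y : ℤ, a * x ^ 2 + 2 * b * x * y + c * y ^ 2 = N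

theorem BinaryRep.shift {N a b c : ℤ} (h : BinaryRep N a b c) (k : ℤ) :
    BinaryRep N a (b + k * a) (c + 2 * k * b + k ^ 2 * a) := by
  obtain ⟨ha, hd, x, y, hN⟩ := h
  exact ⟨ha, by linear_combination hd, x - k * y, y, by linear_combination hN⟩

theorem BinaryRep.swap {N a b c : ℤ} (h : BinaryRep N a b c) : BinaryRep N c b a := by
  obtain ⟨ha, hd, x, y, hN⟩ := h
  exact ⟨by nlinarith [sq_nonneg b], by linear_combination hd, y, x, by linear_combination hN⟩

theorem BinaryRep.exists_sq_add_three_mul_sq {N : ℤ} (hN : Odd N) {a b c : ℤ}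
    (h : BinaryRep N a b c) : ∃ u v : ℤ, u ^ 2 + 3 * v ^ 2 = N := by
  induction hm : a.toNat using Nat.strong_induction_on generalizing a b c with
  | _ m ih =>
  obtain ⟨k, hk⟩ := exists_abs_two_mul_add_mul_le h.1 b
  replace h := h.shift k
  generalize b + k * a = b at *
  generalize c + 2 * k * _ + k ^ 2 * a = c at *
  have ha := h.1
  by_cases hc : c < a
  · exact ih _ (by omega) h.swap rfl
  obtain ⟨-, hd, x, y, hxy⟩ := h
  have hb := sq_le_sq' (abs_le.1 hk).1 (abs_le.1 hk).2
  have ha2 : a ≤ 2 := by nlinarith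
  obtain ⟨hk₁, hk₂⟩ := abs_le.1 hk
  interval_cases a
  · obtain rfl : b = 0 := by omega
    obtain rfl : c = 3 := by omega
    exact ⟨x, y, by linear_combination hxy⟩
  · obtain ⟨n, rfl⟩ := hN
    obtain ⟨hb₁, hb₂⟩ : -1 ≤ b ∧ b ≤ 1 := by omega
    obtain rfl : c = 2 := by interval_cases b <;> omega
    exfalso
    have : 2 * (x ^ 2 + b * x * y + y ^ 2 - n) = 1 := by linear_combination hxy
    omega

/-- The ternary form with Gram matrix `!![a, b, r; b, c, s; r, s, t]` is positive definite of
determinant `3`, and its adjoint form represents `N`. -/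
def AdjointRep (N a b c r s t : ℤ) : Prop :=
  0 < a ∧ 0 < a * c - b ^ 2 ∧
    a * (c * t - s ^ 2) + b * (r * s - b * t) + r * (b * s - c * r) = 3 ∧
    ∃ x y z : ℤ, (c * t - s ^ 2) * x ^ 2 + (a * t - r ^ 2) * y ^ 2 + (a * c - b ^ 2) * z ^ 2 +
      2 * (r * s - b * t) * x * y + 2 * (b * s - c * r) * x * z + 2 * (b * r - a * s) * y * z = N

namespace AdjointRep

variable {N a b c r s t : ℤ}

theorem shift₀₁ (h : AdjointRep N a b c r s t) (k : ℤ) :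
    AdjointRep N a (b + k * a) (c + 2 * k * b + k ^ 2 * a) r (s + k * r) t := by
  obtain ⟨ha, hg, hd, x, y, z, hN⟩ := h
  exact ⟨ha, by linarith, by linear_combination hd, x, y + k * x, z, by linear_combination hN⟩

theorem shift₀₂ (h : AdjointRep N a b c r s t) (k : ℤ) :
    AdjointRep N a b c (r + k * a) (s + k * b) (t + 2 * k * r + k ^ 2 * a) := by
  obtain ⟨ha, hg, hd, x, y, z, hN⟩ := h
  exact ⟨ha, hg, by linear_combination hd, x, y, z + k * x, by linear_combination hN⟩

theorem shift₁₂ (h : AdjointRep N a b c r s t) (k : ℤ) :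
    AdjointRep N a b c (r + k * b) (s + k * c) (t + 2 * k * s + k ^ 2 * c) := by
  obtain ⟨ha, hg, hd, x, y, z, hN⟩ := h
  exact ⟨ha, hg, by linear_combination hd, x, y, z + k * y, by linear_combination hN⟩

theorem swap₀₁ (h : AdjointRep N a b c r s t) : AdjointRep N c b a s r t := by
  obtain ⟨ha, hg, hd, x, y, z, hN⟩ := h
  exact ⟨by nlinarith [sq_nonneg b], by linarith, by linear_combination hd, y, x, z,
    by linear_combination hN⟩

theorem mul_sub_sq (h : AdjointRep N a b c r s t) :
    (a * c - b ^ 2) * (a * t - r ^ 2) - (a * s - b * r) ^ 2 = 3 * a := by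
  linear_combination a * h.2.2.1

theorem swap₁₂ (h : AdjointRep N a b c r s t) : AdjointRep N a r t b s c := by
  have hm := h.mul_sub_sq
  obtain ⟨ha, hg, hd, x, y, z, hN⟩ := h
  refine ⟨ha, ?_, by linear_combination hd, x, z, y, by linear_combination hN⟩
  exact pos_of_mul_pos_right (a := a * c - b ^ 2)
    (by nlinarith [sq_nonneg (a * s - b * r)]) hg.le

theorem exists_of_reduced (h : AdjointRep N a b c r s t) (hN : N % 3 = 1)
    (hb : |2 * b| ≤ a) (hr : |2 * r| ≤ a) (hs : |2 * (a * s - b * r)| ≤ a * c - b ^ 2)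
    (hac : a ≤ c) (hg : a * c - b ^ 2 ≤ a * t - r ^ 2) :
    ∃ X Y Z : ℤ, 3 * X ^ 2 + 3 * Y ^ 2 + Z ^ 2 = N := by
  have hm := h.mul_sub_sq
  obtain ⟨ha, hg₀, hd, x, y, z, hxyz⟩ := h
  have hb' := sq_le_sq' (abs_le.1 hb).1 (abs_le.1 hb).2
  have hs' := sq_le_sq' (abs_le.1 hs).1 (abs_le.1 hs).2
  have h₁ : (a * c - b ^ 2) ^ 2 ≤ 4 * a := by nlinarith
  have h₂ : 3 * a ^ 2 ≤ 4 * (a * c - b ^ 2) := by nlinarith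
  have h₃ : 9 * a ^ 3 ≤ 64 := by
    have : (3 * a ^ 2) ^ 2 ≤ (4 * (a * c - b ^ 2)) ^ 2 := pow_le_pow_left₀ (by positivity) h₂ 2
    have : a * (9 * a ^ 3) ≤ a * 64 := by nlinarith
    exact le_of_mul_le_mul_left this ha
  have ha1 : a = 1 := by
    by_contra hne
    have : 2 ≤ a := by omega
    have := pow_le_pow_left₀ (by norm_num) this 3
    omega
  subst ha1
  obtain rfl : b = 0 := by rw [abs_le] at hb; omega
  obtain rfl : r = 0 := by rw [abs_le] at hr; omega
  ring_nf at hs h₁ hd hac hxyz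
  have hc : c ≤ 2 := by nlinarith
  rw [abs_le] at hs
  interval_cases c
  · obtain rfl : s = 0 := by omega
    obtain rfl : t = 3 := by omega
    exact ⟨x, y, z, by linear_combination hxyz⟩
  · exfalso
    obtain ⟨hs₁, hs₂⟩ : -1 ≤ s ∧ s ≤ 1 := by omega
    have key (w v : ℤ) (hw : 3 * v + 2 * w ^ 2 = N) : False := by
      have : w % 3 = 0 ∨ w % 3 = 1 ∨ w % 3 = 2 := by omega
      have hw2 : w ^ 2 % 3 = 0 ∨ w ^ 2 % 3 = 1 := by
        rcases this with h | h | h <;> simp [pow_two, Int.mul_emod, h]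
      omega
    interval_cases s
    · obtain rfl : t = 2 := by omega
      exact key (y - z) (x ^ 2 + 2 * y * z) (by linear_combination hxyz)
    · omega
    · obtain rfl : t = 2 := by omega
      exact key (y + z) (x ^ 2 - 2 * y * z) (by linear_combination hxyz)

theorem exists_three_mul_sq_add (h : AdjointRep N a b c r s t) (hN : N % 3 = 1) :
    ∃ X Y Z : ℤ, 3 * X ^ 2 + 3 * Y ^ 2 + Z ^ 2 = N := by
  induction hm : a.toNat using Nat.strong_induction_on generalizing a b c r s t with
  | _ m ih =>
  induction hl : (a * c - b ^ 2).toNat using Nat.strong_induction_on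
    generalizing b c r s t with
  | _ l ih' =>
  have ha := h.1
  have hg := h.2.1
  obtain ⟨k₁, hk₁⟩ := exists_abs_two_mul_add_mul_le hg (a * s - b * r)
  obtain ⟨k₂, hk₂⟩ := exists_abs_two_mul_add_mul_le ha b
  obtain ⟨k₃, hk₃⟩ := exists_abs_two_mul_add_mul_le ha (r + k₁ * b)
  have h' := ((h.shift₁₂ k₁).shift₀₁ k₂).shift₀₂ k₃
  have e₁ : a * (c + 2 * k₂ * b + k₂ ^ 2 * a) - (b + k₂ * a) ^ 2 = a * c - b ^ 2 := by ring
  by_cases hc : c + 2 * k₂ * b + k₂ ^ 2 * a < a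
  · exact ih _ (by omega) h'.swap₀₁ rfl
  by_cases hG : a * (t + 2 * k₁ * s + k₁ ^ 2 * c + 2 * k₃ * (r + k₁ * b) + k₃ ^ 2 * a) -
      (r + k₁ * b + k₃ * a) ^ 2 < a * c - b ^ 2
  · exact ih' _ (by omega) h'.swap₁₂ rfl
  refine h'.exists_of_reduced hN hk₂ hk₃ ?_ (not_lt.1 hc) (by rw [e₁]; exact not_lt.1 hG)
  rw [e₁]
  convert hk₁ using 2
  ring

end AdjointRep

theorem exists_three_mul_sq_add_of_mod_twelve {N : ℕ} (hN : N % 12 = 7) :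
    ∃ X Y Z : ℤ, 3 * X ^ 2 + 3 * Y ^ 2 + Z ^ 2 = N := by
  have hcop : IsCoprime (-3 : ℤ) N := by
    rw [IsCoprime.neg_left_iff, ← Nat.cast_ofNat (n := 3), Nat.isCoprime_iff_coprime,
      Nat.Prime.coprime_iff_not_dvd Nat.prime_three]
    omega
  obtain ⟨p, hp2, hp, hpN⟩ :=
    Nat.forall_exists_prime_gt_and_zmodEq 2 (by omega : N ≠ 0) hcop
  have hpodd : Odd p := hp.odd_of_ne_two (by omega)
  have hJ : jacobiSym (-(N : ℤ)) p = 1 := by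
    rw [jacobiSym_neg_of_mod_four_eq_three (by omega) hpodd, jacobiSym.mod_left' hpN,
      jacobiSym_neg_three (Nat.odd_iff.2 (by omega)) (by omega)]
  obtain ⟨b, a, hab⟩ := exists_sq_add_eq_mul_of_jacobiSym hp hJ
  obtain ⟨t, ht⟩ := hpN.symm.dvd
  have hp0 : (0 : ℤ) < p := by exact_mod_cast hp.pos
  have hN0 : (0 : ℤ) < N := by omega
  have ha : 0 < a := pos_of_mul_pos_right (a := (p : ℤ)) (by nlinarith [sq_nonneg b]) hp0.le
  have h : AdjointRep N a b p 1 0 t :=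
    ⟨ha, by linarith, by linear_combination (-t) * hab - ht, 0, 0, 1,
      by linear_combination -hab⟩
  exact h.exists_three_mul_sq_add (by omega)

theorem sq_emod_eight_of_odd {x : ℤ} (hx : Odd x) : x ^ 2 % 8 = 1 := by
  have : x % 8 = 1 ∨ x % 8 = 3 ∨ x % 8 = 5 ∨ x % 8 = 7 := by
    have := Int.odd_iff.1 hx
    omega
  rcases this with h | h | h | h <;> simp [pow_two, Int.mul_emod, h]

theorem exists_odd_of_even_of_even {N X Y Z : ℤ} (hN : N % 8 = 7) (hX : Odd X) (hY : Even Y)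
    (hZ : Even Z) (h : 3 * X ^ 2 + 3 * Y ^ 2 + Z ^ 2 = N) :
    ∃ X Y Z : ℤ, Odd X ∧ Odd Y ∧ Odd Z ∧ 3 * X ^ 2 + 3 * Y ^ 2 + Z ^ 2 = N := by
  obtain ⟨y, rfl⟩ := hY.two_dvd
  obtain ⟨z, rfl⟩ := hZ.two_dvd
  have hX' := sq_emod_eight_of_odd hX
  have hodd : Odd (3 * y ^ 2 + z ^ 2) := by
    rw [Int.odd_iff]
    ring_nf at h ⊢
    omega
  refine ⟨X, z - y, z + 3 * y, hX, ?_, ?_, by linear_combination h⟩ <;>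
  · simp only [Int.odd_add, Int.odd_sub, Int.odd_mul, Int.odd_pow, Int.even_mul, Int.even_pow]
      at hodd ⊢
    simp only [← Int.not_even_iff_odd] at *
    have h3 : ¬ Even (3 : ℤ) := by decide
    tauto

theorem exists_odd_three_mul_sq_add {N : ℕ} (hN : N % 24 = 7) :
    ∃ X Y Z : ℤ, Odd X ∧ Odd Y ∧ Odd Z ∧ 3 * X ^ 2 + 3 * Y ^ 2 + Z ^ 2 = N := by
  obtain ⟨X, Y, Z, h⟩ := exists_three_mul_sq_add_of_mod_twelve (N := N) (by omega)
  have sq_even {x : ℤ} (hx : Even x) : x ^ 2 % 4 = 0 := by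
    obtain ⟨y, rfl⟩ := hx.two_dvd
    rw [mul_pow]
    omega
  rcases Int.even_or_odd X with hX | hX <;> rcases Int.even_or_odd Y with hY | hY <;>
    rcases Int.even_or_odd Z with hZ | hZ
  · have := sq_even hX
    have := sq_even hY
    have := sq_even hZ
    omega
  · have := sq_even hX
    have := sq_even hY
    have := sq_emod_eight_of_odd hZ
    omega
  · exact exists_odd_of_even_of_even (by omega) hY hX hZ (by linarith)
  · have := sq_even hX
    have := sq_emod_eight_of_odd hY
    have := sq_emod_eight_of_odd hZ
    omega
  · exact exists_odd_of_even_of_even (by omega) hX hY hZ h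
  · have := sq_emod_eight_of_odd hX
    have := sq_even hY
    have := sq_emod_eight_of_odd hZ
    omega
  · have := sq_emod_eight_of_odd hX
    have := sq_emod_eight_of_odd hY
    have := sq_even hZ
    omega
  · exact ⟨X, Y, Z, hX, hY, hZ, h⟩

/-- `N` has a representation `3 X² + 3 Y² + Z²` with `X`, `Y` odd and `Z ≡ ±1 [ZMOD 12]`. -/
def GoodRep (N : ℤ) : Prop :=
  ∃ X Y Z : ℤ, Odd X ∧ Odd Y ∧ (Z % 12 = 1 ∨ Z % 12 = 11) ∧ 3 * X ^ 2 + 3 * Y ^ 2 + Z ^ 2 = N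

theorem goodRep_of_not_dvd {N : ℤ} (k : ℕ) {X Y Z : ℤ} (hZ : Odd Z) (hZ3 : Z % 3 ≠ 0)
    (hX : 4 ∣ Z - X) (hY : 4 ∣ Z - Y) (h : 3 * X ^ 2 + 3 * Y ^ 2 + Z ^ 2 = N)
    (hk : ¬ 2 ^ (k + 2) ∣ Z - X) : GoodRep N := by
  induction k generalizing X Y Z with
  | zero => exact absurd hX hk
  | succ k ih =>
  by_cases hkX : 2 ^ (k + 2) ∣ Z - X
  swap
  · exact ih hZ hZ3 hX hY h hkX
  by_cases hkY : 2 ^ (k + 2) ∣ Z - Y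
  swap
  · exact ih hZ hZ3 hY hX (by linarith) hkY
  rw [Int.odd_iff] at hZ
  obtain ⟨b, hb⟩ := hX
  have h' : 3 * (X + 2 * b) ^ 2 + 3 * Y ^ 2 + (Z - 6 * b) ^ 2 = N := by
    linear_combination h - 12 * b * hb
  rcases Nat.eq_zero_or_pos k with rfl | hk0
  · norm_num at hk
    have hX : Odd X := Int.odd_iff.2 (by omega)
    have hX' : Odd (X + 2 * b) := Int.odd_iff.2 (by omega)
    have hY : Odd Y := Int.odd_iff.2 (by omega)
    by_cases hgood : Z % 12 = 1 ∨ Z % 12 = 11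
    · exact ⟨X, Y, Z, hX, hY, hgood, h⟩
    · have hZ' : Z % 12 = 5 ∨ Z % 12 = 7 := by
        have : Z % 12 % 2 = 1 := by omega
        have : Z % 12 % 3 ≠ 0 := by omega
        omega
      exact ⟨X + 2 * b, Y, Z - 6 * b, hX', hY, by omega, h'⟩
  · have h8 : (8 : ℤ) ∣ 2 ^ (k + 2) := pow_dvd_pow 2 (by omega : 3 ≤ k + 2)
    have h8' := h8.trans hkX
    refine ih (X := Y) (Y := X + 2 * b) (Z := Z - 6 * b) (Int.odd_iff.2 (by omega)) (by omega)
      (by omega) (by omega) (by linarith) fun hdvd ↦ hk ?_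
    obtain ⟨u, hu⟩ := hkY.sub hdvd
    have h12 : (2 : ℤ) ^ (k + 1 + 2) ∣ 3 * (Z - X) :=
      ⟨u, by rw [pow_succ] at hu ⊢; linear_combination 2 * hu + 3 * hb⟩
    have hcop : IsCoprime ((2 : ℤ) ^ (k + 1 + 2)) 3 := IsCoprime.pow_left (by norm_num)
    exact hcop.dvd_of_dvd_mul_left h12

theorem goodRep_of_sq_ne_sq {N X Y Z : ℤ} (hX : Odd X) (hY : Odd Y) (hZ : Odd Z)
    (hZ3 : Z % 3 ≠ 0) (hne : X ^ 2 ≠ Z ^ 2) (h : 3 * X ^ 2 + 3 * Y ^ 2 + Z ^ 2 = N) :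
    GoodRep N := by
  have normalize {x : ℤ} (hx : Odd x) : ∃ x' : ℤ, x' ^ 2 = x ^ 2 ∧ 4 ∣ Z - x' := by
    rw [Int.odd_iff] at hx hZ
    by_cases h4 : 4 ∣ Z - x
    · exact ⟨x, rfl, h4⟩
    · exact ⟨-x, neg_sq x, by omega⟩
  obtain ⟨X', hX2, hX4⟩ := normalize hX
  obtain ⟨Y', hY2, hY4⟩ := normalize hY
  refine goodRep_of_not_dvd (Z - X').natAbs hZ hZ3 hX4 hY4 (by rw [hX2, hY2, h]) fun hdvd ↦ ?_
  have h0 : Z - X' = 0 := by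
    refine Int.eq_zero_of_abs_lt_dvd hdvd ?_
    rw [Int.abs_eq_natAbs]
    exact_mod_cast Nat.lt_two_pow_self.trans
      (Nat.pow_lt_pow_right one_lt_two (by omega : (Z - X').natAbs < (Z - X').natAbs + 2))
  exact hne (by rw [← hX2, sub_eq_zero.1 h0])

theorem Nat.exists_prime_dvd_mod_twelve (m : ℕ) (hm : m % 12 = 5 ∨ m % 12 = 7) :
    ∃ p, p.Prime ∧ p ∣ m ∧ (p % 12 = 5 ∨ p % 12 = 7) := by
  induction m using Nat.strong_induction_on with
  | _ m ih =>
  obtain ⟨p, hp, q, rfl⟩ := Nat.exists_prime_and_dvd (n := m) (by omega)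
  by_cases hp5 : p % 12 = 5 ∨ p % 12 = 7
  · exact ⟨p, hp, dvd_mul_right p q, hp5⟩
  have hq0 : 0 < q := Nat.pos_of_ne_zero (by rintro rfl; simp at hm)
  have hlt : q < p * q := (Nat.lt_mul_iff_one_lt_left hq0).2 hp.one_lt
  have hq : q % 12 = 5 ∨ q % 12 = 7 := by
    rw [Nat.mul_mod] at hm
    have h₁ := Nat.mod_lt p (by norm_num : 12 > 0)
    have h₂ := Nat.mod_lt q (by norm_num : 12 > 0)
    generalize p % 12 = i at *
    generalize q % 12 = j at *
    interval_cases i <;> omega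
  obtain ⟨r, hr, hrq, hr5⟩ := ih q hlt hq
  exact ⟨r, hr, hrq.mul_left p, hr5⟩

theorem Nat.Prime.sq_ne_natCast {p : ℕ} (hp : p.Prime) (u : ℤ) : u ^ 2 ≠ p := fun h ↦
  (Nat.prime_iff_prime_int.1 hp).irreducible.not_isSquare ⟨u, by rw [← h, sq]⟩

theorem exists_seven_mul_prime_sq {p : ℕ} (hp : p.Prime) (h : p % 12 = 5 ∨ p % 12 = 7) :
    ∃ X Y Z : ℤ, Odd X ∧ Odd Y ∧ Odd Z ∧ Z % 3 ≠ 0 ∧ X ^ 2 ≠ Z ^ 2 ∧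
      3 * X ^ 2 + 3 * Y ^ 2 + Z ^ 2 = 7 * p ^ 2 := by
  have : Fact p.Prime := ⟨hp⟩
  have hpodd : Odd (p : ℤ) := Int.odd_iff.2 (by omega)
  rcases h with h | h
  · obtain ⟨u, v, huv⟩ := Nat.Prime.sq_add_sq (p := p) (by omega)
    zify at huv
    generalize (u : ℤ) = u at huv
    generalize (v : ℤ) = v at huv
    have hodd : Odd (u ^ 2 - v ^ 2) := by
      rw [show u ^ 2 - v ^ 2 = p - 2 * v ^ 2 by linarith]
      exact hpodd.sub_even (even_two_mul _)
    refine ⟨u ^ 2 - v ^ 2 + 2 * (u * v), u ^ 2 - v ^ 2 - 2 * (u * v), p,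
      hodd.add_even (even_two_mul _), hodd.sub_even (even_two_mul _), hpodd, by omega, ?_, ?_⟩
    · intro heq
      have h0 : (u * v) * (u ^ 2 - v ^ 2) = 0 := by
        rw [← huv] at heq
        linarith
      rcases mul_eq_zero.1 h0 with h0 | h0
      · rcases mul_eq_zero.1 h0 with rfl | rfl
        · exact hp.sq_ne_natCast v (by linarith)
        · exact hp.sq_ne_natCast u (by linarith)
      · simp [h0] at hodd
    · rw [← huv]
      ring
  · obtain ⟨b, k, hbk⟩ := exists_sq_add_eq_mul_of_jacobiSym hp
      (jacobiSym_neg_three (Nat.odd_iff.2 (by omega)) (by omega : p % 3 = 1))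
    have hrep : BinaryRep p p b k :=
      ⟨by exact_mod_cast hp.pos, by linarith, 1, 0, by ring⟩
    obtain ⟨u, v, huv⟩ := hrep.exists_sq_add_three_mul_sq hpodd
    have hodd : Odd (u ^ 2 - 3 * v ^ 2) := by
      rw [show u ^ 2 - 3 * v ^ 2 = p - 2 * (3 * v ^ 2) by linarith]
      exact hpodd.sub_even (even_two_mul _)
    have hu : u ≠ 0 := by
      rintro rfl
      omega
    have hv : v ≠ 0 := by
      rintro rfl
      exact hp.sq_ne_natCast u (by linarith)
    refine ⟨u ^ 2 - 3 * v ^ 2 - 2 * (u * v), p, u ^ 2 - 3 * v ^ 2 + 2 * (3 * (u * v)),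
      hodd.sub_even (even_two_mul _), hpodd, hodd.add_even (even_two_mul _), ?_, ?_, ?_⟩
    · intro h3
      have hu3 : u ^ 2 % 3 = 1 := by omega
      omega
    · intro heq
      have h0 : (u * v) * (u ^ 2 - 3 * v ^ 2 + 2 * (u * v)) = 0 := by linarith
      rcases mul_eq_zero.1 h0 with h0 | h0
      · exact (mul_ne_zero hu hv) h0
      · have := hodd.add_even (even_two_mul (u * v))
        simp [h0] at this
    · rw [← huv]
      ring

theorem goodRep_seven_mul_sq {m : ℤ} (hm : m % 2 = 1) (hm3 : m % 3 ≠ 0) :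
    GoodRep (7 * m ^ 2) := by
  by_cases h : m % 12 = 1 ∨ m % 12 = 11
  · have hodd := Int.odd_iff.2 hm
    exact ⟨m, m, m, hodd, hodd, h, by ring⟩
  obtain ⟨p, hp, ⟨q, hq⟩, hp5⟩ := m.natAbs.exists_prime_dvd_mod_twelve (by
    have : m % 12 % 2 = 1 := by omega
    have : m % 12 % 3 ≠ 0 := by omega
    have : m % 12 = 5 ∨ m % 12 = 7 := by omega
    omega)
  obtain ⟨X, Y, Z, hX, hY, hZ, hZ3, hne, hXYZ⟩ := exists_seven_mul_prime_sq hp hp5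
  have hm2 : m ^ 2 = (p * q) ^ 2 := by
    rw [← Int.natAbs_sq, hq]
    push_cast
    ring
  have hqodd : Odd (q : ℤ) := by
    have : Odd (p * q) := by
      rw [← hq, Nat.odd_iff]
      omega
    exact_mod_cast (Nat.odd_mul.1 this).2
  have hq3 : ¬ (3 : ℤ) ∣ q := fun h3 ↦ by
    have : 3 ∣ p * q := (Int.natCast_dvd_natCast.1 h3).mul_left p
    omega
  have hq0 : (q : ℤ) ≠ 0 := by
    rintro h0
    simp [h0] at hq3
  refine goodRep_of_sq_ne_sq (hqodd.mul hX) (hqodd.mul hY) (hqodd.mul hZ) ?_ ?_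
    (by rw [hm2]; linear_combination (q : ℤ) ^ 2 * hXYZ)
  · intro h3
    rcases Int.prime_three.dvd_or_dvd (Int.dvd_of_emod_eq_zero h3) with h | h <;> omega
  · rw [mul_pow, mul_pow]
    exact fun heq ↦ hne (mul_left_cancel₀ (pow_ne_zero 2 hq0) heq)

theorem goodRep_of_mod_twenty_four {N : ℕ} (hN : N % 24 = 7) : GoodRep N := by
  obtain ⟨X, Y, Z, hX, hY, hZ, h⟩ := exists_odd_three_mul_sq_add hN
  have hZ3 : Z % 3 ≠ 0 := by
    intro h3
    obtain ⟨z, rfl⟩ := Int.dvd_of_emod_eq_zero h3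
    rw [mul_pow] at h
    omega
  by_cases hXZ : X ^ 2 = Z ^ 2
  · by_cases hYZ : Y ^ 2 = Z ^ 2
    · rw [← h, hXZ, hYZ, show 3 * Z ^ 2 + 3 * Z ^ 2 + Z ^ 2 = 7 * Z ^ 2 by ring]
      exact goodRep_seven_mul_sq (Int.odd_iff.1 hZ) hZ3
    · exact goodRep_of_sq_ne_sq hY hX hZ hZ3 hYZ (by linarith)
  · exact goodRep_of_sq_ne_sq hX hY hZ hZ3 hXZ h

theorem exists_sq_eq_four_mul_add_one {X : ℤ} (hX : Odd X) : ∃ x : ℤ, X ^ 2 = (4 * x + 1) ^ 2 := by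
  rw [Int.odd_iff] at hX
  rcases (by omega : X % 4 = 1 ∨ X % 4 = 3) with h | h
  · exact ⟨X / 4, by rw [show 4 * (X / 4) + 1 = X by omega]⟩
  · exact ⟨-X / 4, by rw [show 4 * (-X / 4) + 1 = -X by omega, neg_sq]⟩

/-- The ternary sum `x(2x+1) + y(2y+1) + z(6z+1)` is universal: for every
non negative integer `n`, the equation `x(2x+1) + y(2y+1) + z(6z+1) = n`
has an integer solution `x, y, z`. -/
theorem universal_2_2_6 (n : ℤ) (hn : 0 ≤ n) :
    ∃ x y z : ℤ, x * (2 * x + 1) + y * (2 * y + 1) + z * (6 * z + 1) = n := by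
  lift n to ℕ using hn
  obtain ⟨X, Y, Z, hX, hY, hZ, h⟩ := goodRep_of_mod_twenty_four (N := 24 * n + 7) (by omega)
  obtain ⟨x, hx⟩ := exists_sq_eq_four_mul_add_one hX
  obtain ⟨y, hy⟩ := exists_sq_eq_four_mul_add_one hY
  obtain ⟨z, hz⟩ : ∃ z : ℤ, Z ^ 2 = (12 * z + 1) ^ 2 := by
    rcases hZ with hZ | hZ
    · exact ⟨Z / 12, by rw [show 12 * (Z / 12) + 1 = Z by omega]⟩
    · exact ⟨-Z / 12, by rw [show 12 * (-Z / 12) + 1 = -Z by omega, neg_sq]⟩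
  rw [hx, hy, hz] at h
  push_cast at h
  exact ⟨x, y, z, by linarith⟩
end

section
/- The ternary sum x(2x+1) + y(3y+1) + z(7z+1) is universal; that is, for every non negative integer n, the equation x(2x+1) + y(3y+1) + z(7z+1) = n has an integer solution x, y, z. -/
/-- The target form: `m` is represented by `21X² + 6Y² + 14Z²`. -/
def IsRep (m : ℤ) : Prop := ∃ X Y Z : ℤ, 21 * X ^ 2 + 6 * Y ^ 2 + 14 * Z ^ 2 = m

lemma isRep_of_dvd {m a b c : ℤ} (hn : a ^ 2 + b ^ 2 + c ^ 2 = m) (ha : a % 2 = 1)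
    (hb : b % 2 = 0) (hc : c % 2 = 0) (h3 : 3 ∣ a - b - c) (h7 : 7 ∣ a + 2 * b + 3 * c) :
    IsRep m := by
  obtain ⟨X, hX⟩ : (21 : ℤ) ∣ a + 2 * b - 4 * c := by omega
  obtain ⟨Y, hY⟩ : (6 : ℤ) ∣ 2 * a + b + c := by omega
  obtain ⟨Z, hZ⟩ : (14 : ℤ) ∣ 2 * a - 3 * b - c := by omega
  refine ⟨X, Y, Z, ?_⟩
  have e1 : a = X + 2 * Y + 2 * Z := by omega
  have e2 : b = 2 * X + Y - 3 * Z := by omega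
  have e3 : c = -4 * X + Y - Z := by omega
  rw [← hn, e1, e2, e3]
  ring

lemma universal_of_isRep {n : ℤ} (h : IsRep (168 * n + 41)) :
    ∃ x y z : ℤ, x * (2 * x + 1) + y * (3 * y + 1) + z * (7 * z + 1) = n := by
  obtain ⟨X, Y, Z, h⟩ := h
  have key₈ : ∀ X Y Z : ZMod 8, 21 * X ^ 2 + 6 * Y ^ 2 + 14 * Z ^ 2 = 1 →
      4 * (X - 1) = 0 ∧ 4 * (Y - 1) = 0 ∧ 4 * (Z - 1) = 0 := by decide
  have key₃ : ∀ X Y Z : ZMod 3, 21 * X ^ 2 + 6 * Y ^ 2 + 14 * Z ^ 2 = 2 →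
      Z - 1 = 0 ∨ Z + 1 = 0 := by decide
  have key₇ : ∀ X Y Z : ZMod 7, 21 * X ^ 2 + 6 * Y ^ 2 + 14 * Z ^ 2 = 6 →
      Y - 1 = 0 ∨ Y + 1 = 0 := by decide
  have cast (k : ℕ) (r : ℤ) (hr : (k : ℤ) ∣ r - (168 * n + 41)) :
      21 * (X : ZMod k) ^ 2 + 6 * (Y : ZMod k) ^ 2 + 14 * (Z : ZMod k) ^ 2 = (r : ZMod k) := by
    rw [← (ZMod.intCast_eq_intCast_iff_dvd_sub _ _ _).mpr hr, ← h]
    push_cast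
    ring
  have h8 := key₈ X Y Z (by exact_mod_cast cast 8 1 (by omega))
  have h3 := key₃ X Y Z (by exact_mod_cast cast 3 2 (by omega))
  have h7 := key₇ X Y Z (by exact_mod_cast cast 7 6 (by omega))
  norm_cast at h8 h3 h7
  simp only [ZMod.intCast_zmod_eq_zero_iff_dvd] at h8 h3 h7
  push_cast at h8 h3 h7
  obtain ⟨x, hx⟩ : ∃ x, X = 4 * x + 1 ∨ X = -(4 * x + 1) := by
    rcases Int.emod_two_eq_zero_or_one ((X - 1) / 2) with h | h
    · exact ⟨(X - 1) / 4, by omega⟩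
    · exact ⟨(-X - 1) / 4, by omega⟩
  obtain ⟨y, hy⟩ : ∃ y, Z = 6 * y + 1 ∨ Z = -(6 * y + 1) := by
    rcases h3 with h | h
    · exact ⟨(Z - 1) / 6, by omega⟩
    · exact ⟨(-Z - 1) / 6, by omega⟩
  obtain ⟨z, hz⟩ : ∃ z, Y = 14 * z + 1 ∨ Y = -(14 * z + 1) := by
    rcases h7 with h | h
    · exact ⟨(Y - 1) / 14, by omega⟩
    · exact ⟨(-Y - 1) / 14, by omega⟩
  have hX : X ^ 2 = (4 * x + 1) ^ 2 := by rcases hx with rfl | rfl <;> ring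
  have hY : Y ^ 2 = (14 * z + 1) ^ 2 := by rcases hz with rfl | rfl <;> ring
  have hZ : Z ^ 2 = (6 * y + 1) ^ 2 := by rcases hy with rfl | rfl <;> ring
  refine ⟨x, y, z, ?_⟩
  rw [hX, hY, hZ] at h
  linarith

/-- A number `m ≡ 41 (mod 168)` that is not represented by `21X² + 6Y² + 14Z²`, with a vector of
norm `m` whose odd coordinate comes first and which is not an integer multiple `t • w` of a vector
`w` of norm `17`. Such vectors do not exist, see `Adm.false`. -/
structure Adm (m a b c : ℤ) : Prop where
  not_isRep : ¬ IsRep m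
  mod : m % 168 = 41
  norm : a ^ 2 + b ^ 2 + c ^ 2 = m
  odd : a % 2 = 1
  even₂ : b % 2 = 0
  even₃ : c % 2 = 0
  prim : ∀ t : ℤ, m = 17 * t ^ 2 → ¬(t ∣ a ∧ t ∣ b ∧ t ∣ c)

section Moves

variable {m a b c : ℤ}

lemma sign_cases {s : ℤ} (hs : s * s = 1) : s = 1 ∨ s = -1 := by
  have : (s - 1) * (s + 1) = 0 := by linarith
  rcases mul_eq_zero.mp this with h | h <;> omega

lemma Adm.neg_snd (h : Adm m a b c) : Adm m a (-b) c where
  not_isRep := h.not_isRep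
  mod := h.mod
  norm := by rw [← h.norm]; ring
  odd := h.odd
  even₂ := by have := h.even₂; omega
  even₃ := h.even₃
  prim t ht := by rw [dvd_neg]; exact h.prim t ht

lemma Adm.swap (h : Adm m a b c) : Adm m a c b where
  not_isRep := h.not_isRep
  mod := h.mod
  norm := by rw [← h.norm]; ring
  odd := h.odd
  even₂ := h.even₃
  even₃ := h.even₂
  prim t ht := by have := h.prim t ht; tauto

lemma Adm.neg_trd (h : Adm m a b c) : Adm m a b (-c) := h.swap.neg_snd.swap

lemma Adm.not_dvd₂₃ (h : Adm m a b c) (s t : ℤ)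
    (h3 : 3 ∣ a + s * b + t * c) (h7 : 7 ∣ a + 2 * (-s) * b + 3 * (-t) * c)
    (hs : s * s = 1 := by decide) (ht : t * t = 1 := by decide) : False := by
  apply h.not_isRep
  rcases sign_cases hs with rfl | rfl <;> rcases sign_cases ht with rfl | rfl
  · exact isRep_of_dvd h.neg_snd.neg_trd.norm h.odd h.neg_snd.even₂ h.neg_trd.even₃
      (by omega) (by omega)
  · exact isRep_of_dvd h.neg_snd.norm h.odd h.neg_snd.even₂ h.even₃ (by omega) (by omega)
  · exact isRep_of_dvd h.neg_trd.norm h.odd h.even₂ h.neg_trd.even₃ (by omega) (by omega)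
  · exact isRep_of_dvd h.norm h.odd h.even₂ h.even₃ (by omega) (by omega)

lemma Adm.not_dvd₃₂ (h : Adm m a b c) (s t : ℤ)
    (h3 : 3 ∣ a + s * b + t * c) (h7 : 7 ∣ a + 3 * (-s) * b + 2 * (-t) * c)
    (hs : s * s = 1 := by decide) (ht : t * t = 1 := by decide) : False :=
  h.swap.not_dvd₂₃ t s (by convert h3 using 1; ring) (by convert h7 using 1; ring) ht hs

lemma Adm.move₃ (h : Adm m a b c) (s t : ℤ) (h3 : 3 ∣ a + s * b + t * c)
    (hs : s * s = 1 := by decide) (ht : t * t = 1 := by decide) :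
    ∃ k, 3 * k = a + s * b + t * c ∧ Adm m (a - 2 * k) (b - 2 * (s * k)) (c - 2 * (t * k)) := by
  obtain ⟨k, hk⟩ := h3
  refine ⟨k, hk.symm, h.not_isRep, h.mod, ?_, ?_, ?_, ?_, ?_⟩
  · rw [← h.norm]
    linear_combination (-4 * k) * hk + 4 * k ^ 2 * hs + 4 * k ^ 2 * ht
  · have := h.odd; omega
  · have := h.even₂; omega
  · have := h.even₃; omega
  · rintro r hr ⟨ha, hb, hc⟩
    have h17 : IsCoprime r 3 := by
      rw [isCoprime_comm, Int.prime_three.coprime_iff_not_dvd]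
      rintro ⟨u, rfl⟩
      have : m = 3 * (51 * u ^ 2) := by rw [hr]; ring
      have := h.mod
      omega
    have hd : r ∣ k := by
      have : -(3 * k) = (a - 2 * k) + s * (b - 2 * (s * k)) + t * (c - 2 * (t * k)) := by
        linear_combination -hk + 2 * k * hs + 2 * k * ht
      have h2 : r ∣ 3 * k := by
        rw [← dvd_neg, this]
        exact dvd_add (dvd_add ha (hb.mul_left _)) (hc.mul_left _)
      exact h17.dvd_of_dvd_mul_left h2
    refine h.prim r hr ⟨?_, ?_, ?_⟩
    · have := dvd_add ha (hd.mul_left 2); simpa using this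
    · have := dvd_add hb ((hd.mul_left s).mul_left 2); simpa using this
    · have := dvd_add hc ((hd.mul_left t).mul_left 2); simpa using this

lemma Adm.move₂₃ (h : Adm m a b c) (s t : ℤ)
    (h7 : 7 ∣ a + 2 * s * b + 3 * t * c)
    (hs : s * s = 1 := by decide) (ht : t * t = 1 := by decide) :
    ∃ k, 7 * k = a + 2 * s * b + 3 * t * c ∧ Adm m (c - 3 * t * k) (a - k) (b - 2 * s * k) := by
  obtain ⟨k, hk⟩ := h7
  have hk2 : k % 2 = 1 := by
    have := h.odd; have := h.even₂; have := h.even₃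
    rcases sign_cases hs with rfl | rfl <;> rcases sign_cases ht with rfl | rfl <;> omega
  refine ⟨k, hk.symm, h.not_isRep, h.mod, ?_, ?_, ?_, ?_, ?_⟩
  · rw [← h.norm]
    linear_combination (-2 * k) * hk + 4 * k ^ 2 * hs + 9 * k ^ 2 * ht
  · have := h.even₃; rcases sign_cases ht with rfl | rfl <;> omega
  · have := h.odd; omega
  · have := h.even₂; rcases sign_cases hs with rfl | rfl <;> omega
  · rintro r hr ⟨hc, ha, hb⟩
    have h17 : IsCoprime r 7 := by
      rw [isCoprime_comm, (by norm_num : Prime (7 : ℤ)).coprime_iff_not_dvd]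
      rintro ⟨u, rfl⟩
      have : m = 7 * (119 * u ^ 2) := by rw [hr]; ring
      have := h.mod
      omega
    have hd : r ∣ k := by
      have : -(7 * k) = (a - k) + 2 * s * (b - 2 * s * k) + 3 * t * (c - 3 * t * k) := by
        linear_combination -hk + 4 * k * hs + 9 * k * ht
      have h2 : r ∣ 7 * k := by
        rw [← dvd_neg, this]
        exact dvd_add (dvd_add ha (hb.mul_left _)) (hc.mul_left _)
      exact h17.dvd_of_dvd_mul_left h2
    refine h.prim r hr ⟨?_, ?_, ?_⟩
    · have := dvd_add ha hd; simpa using this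
    · have := dvd_add hb (hd.mul_left (2 * s)); simpa using this
    · have := dvd_add hc (hd.mul_left (3 * t)); simpa using this

lemma Adm.move₃₂ (h : Adm m a b c) (s t : ℤ)
    (h7 : 7 ∣ a + 3 * s * b + 2 * t * c)
    (hs : s * s = 1 := by decide) (ht : t * t = 1 := by decide) :
    ∃ k, 7 * k = a + 3 * s * b + 2 * t * c ∧ Adm m (b - 3 * s * k) (a - k) (c - 2 * t * k) := by
  obtain ⟨k, hk, h'⟩ := h.swap.move₂₃ t s (by convert h7 using 1; ring) ht hs
  exact ⟨k, by rw [hk]; ring, h'⟩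

lemma dvd_iff_zmod₃ (x : ℤ) : 3 ∣ x ↔ (x : ZMod 3) = 0 :=
  (ZMod.intCast_zmod_eq_zero_iff_dvd x 3).symm

lemma dvd_iff_zmod₇ (x : ℤ) : 7 ∣ x ↔ (x : ZMod 7) = 0 :=
  (ZMod.intCast_zmod_eq_zero_iff_dvd x 7).symm

lemma Adm.exists_dvd₃ (h : Adm m a b c) :
    (3 ∣ a + b + c ∧ 3 ∣ a + b - c) ∨ (3 ∣ a + b + c ∧ 3 ∣ a - b + c) ∨
    (3 ∣ a + b - c ∧ 3 ∣ a - b + c) ∨ 3 ∣ a - b - c := by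
  have key : ∀ a b c : ZMod 3, a ^ 2 + b ^ 2 + c ^ 2 = 2 →
    (a + b + c = 0 ∧ a + b - c = 0) ∨ (a + b + c = 0 ∧ a - b + c = 0) ∨
    (a + b - c = 0 ∧ a - b + c = 0) ∨ a - b - c = 0 := by decide
  have h1 : ((a : ZMod 3)) ^ 2 + b ^ 2 + c ^ 2 = 2 := by
    have : ((m : ℤ) : ZMod 3) = ((2 : ℤ) : ZMod 3) := by
      rw [ZMod.intCast_eq_intCast_iff_dvd_sub]; have := h.mod; omega
    rw [← h.norm] at this
    exact_mod_cast this
  have := key a b c h1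
  simp only [dvd_iff_zmod₃]
  push_cast
  exact this

lemma Adm.other₃ (h : Adm m a b c) (s t : ℤ) (h3 : 3 ∣ a + s * b + t * c)
    (hs : s * s = 1 := by decide) (ht : t * t = 1 := by decide) :
    3 ∣ a + s * b + -t * c ∨ 3 ∣ a + -s * b + t * c ∨ 3 ∣ a + -s * b + -t * c := by
  have key : ∀ a b c : ZMod 3, a ^ 2 + b ^ 2 + c ^ 2 = 2 → a + b + c = 0 →
    a + b - c = 0 ∨ a - b + c = 0 ∨ a - b - c = 0 := by decide
  have h1 : (a : ZMod 3) ^ 2 + ((s * b : ℤ) : ZMod 3) ^ 2 + ((t * c : ℤ) : ZMod 3) ^ 2 = 2 := by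
    have h2 : a ^ 2 + (s * b) ^ 2 + (t * c) ^ 2 = m := by
      linear_combination h.norm + b ^ 2 * hs + c ^ 2 * ht
    have : ((m : ℤ) : ZMod 3) = ((2 : ℤ) : ZMod 3) := by
      rw [ZMod.intCast_eq_intCast_iff_dvd_sub]; have := h.mod; omega
    rw [← h2] at this
    exact_mod_cast this
  have := key a (s * b : ℤ) (t * c : ℤ) h1
  simp only [dvd_iff_zmod₃] at h3 ⊢
  push_cast at *
  simp only [neg_mul, ← sub_eq_add_neg]
  exact this h3

lemma Adm.exists_dvd₇ (h : Adm m a b c) :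
    7 ∣ a + 2 * b + 3 * c ∨ 7 ∣ a + 2 * b - 3 * c ∨ 7 ∣ a - 2 * b + 3 * c ∨ 7 ∣ a - 2 * b - 3 * c ∨
    7 ∣ a + 3 * b + 2 * c ∨ 7 ∣ a + 3 * b - 2 * c ∨ 7 ∣ a - 3 * b + 2 * c ∨
      7 ∣ a - 3 * b - 2 * c := by
  have key : ∀ a b c : ZMod 7, a ^ 2 + b ^ 2 + c ^ 2 = 6 →
    a + 2 * b + 3 * c = 0 ∨ a + 2 * b - 3 * c = 0 ∨ a - 2 * b + 3 * c = 0 ∨ a - 2 * b - 3 * c = 0 ∨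
    a + 3 * b + 2 * c = 0 ∨ a + 3 * b - 2 * c = 0 ∨ a - 3 * b + 2 * c = 0 ∨
      a - 3 * b - 2 * c = 0 := by decide
  have h1 : ((a : ZMod 7)) ^ 2 + b ^ 2 + c ^ 2 = 6 := by
    have : ((m : ℤ) : ZMod 7) = ((6 : ℤ) : ZMod 7) := by
      rw [ZMod.intCast_eq_intCast_iff_dvd_sub]; have := h.mod; omega
    rw [← h.norm] at this
    exact_mod_cast this
  have := key a b c h1
  simp only [dvd_iff_zmod₇]
  push_cast
  exact this

lemma Adm.other₇_aux (h : Adm m a b c) (h7 : 7 ∣ a + 2 * b + 3 * c) :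
    7 ∣ a + 2 * b - 3 * c ∨ 7 ∣ a - 2 * b + 3 * c ∨ 7 ∣ a - 2 * b - 3 * c ∨
    7 ∣ a + 3 * b + 2 * c ∨ 7 ∣ a + 3 * b - 2 * c ∨ 7 ∣ a - 3 * b + 2 * c ∨
      7 ∣ a - 3 * b - 2 * c := by
  have key : ∀ a b c : ZMod 7, a ^ 2 + b ^ 2 + c ^ 2 = 6 → a + 2 * b + 3 * c = 0 →
    a + 2 * b - 3 * c = 0 ∨ a - 2 * b + 3 * c = 0 ∨ a - 2 * b - 3 * c = 0 ∨
    a + 3 * b + 2 * c = 0 ∨ a + 3 * b - 2 * c = 0 ∨ a - 3 * b + 2 * c = 0 ∨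
      a - 3 * b - 2 * c = 0 := by decide
  have h1 : ((a : ZMod 7)) ^ 2 + b ^ 2 + c ^ 2 = 6 := by
    have : ((m : ℤ) : ZMod 7) = ((6 : ℤ) : ZMod 7) := by
      rw [ZMod.intCast_eq_intCast_iff_dvd_sub]; have := h.mod; omega
    rw [← h.norm] at this
    exact_mod_cast this
  simp only [dvd_iff_zmod₇] at h7 ⊢
  push_cast at h7 ⊢
  exact key a b c h1 h7

lemma Adm.other₂₃ (h : Adm m a b c) (s t : ℤ)
    (h7 : 7 ∣ a + 2 * s * b + 3 * t * c)
    (hs : s * s = 1 := by decide) (ht : t * t = 1 := by decide) :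
    7 ∣ a + 2 * s * b + 3 * -t * c ∨ 7 ∣ a + 2 * -s * b + 3 * t * c ∨
    7 ∣ a + 2 * -s * b + 3 * -t * c ∨ 7 ∣ a + 3 * b + 2 * c ∨ 7 ∣ a + 3 * b - 2 * c ∨
      7 ∣ a - 3 * b + 2 * c ∨ 7 ∣ a - 3 * b - 2 * c := by
  rcases sign_cases hs with rfl | rfl <;> rcases sign_cases ht with rfl | rfl
  · have := h.other₇_aux (by omega); omega
  · have := h.neg_trd.other₇_aux (by omega); omega
  · have := h.neg_snd.other₇_aux (by omega); omega
  · have := h.neg_snd.neg_trd.other₇_aux (by omega); omega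

end Moves


section Descent

/-- A bounded integer-valued function satisfying a two-step linear recurrence with non-integral
coefficient along the orbits of a relation vanishes. -/
lemma eq_zero_of_recurrence {α : Type*} (S : α → Prop) (R : α → α → Prop) (u : α → ℤ)
    {k s B : ℤ} (hk : 1 < k) (hks : IsCoprime k s) (hB : ∀ v, S v → |u v| ≤ B)
    (hS : ∀ v, S v → ∃ w, S w ∧ R v w)
    (hR : ∀ v w x, R v w → R w x → k * (u x + u v) = s * u w) {v : α} (hv : S v) : u v = 0 := by
  choose! f hfS hfR using hS
  set x : ℕ → α := fun n ↦ f^[n] v with hx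
  have hxS : ∀ n, S (x n) := by
    intro n
    induction n with
    | zero => exact hv
    | succ n ih =>
      simp only [hx, Function.iterate_succ_apply'] at ih ⊢
      exact hfS _ ih
  have hxR : ∀ n, R (x n) (x (n + 1)) := by
    intro n
    have := hfR _ (hxS n)
    simpa only [hx, Function.iterate_succ_apply'] using this
  have hrec : ∀ n, k * (u (x (n + 2)) + u (x n)) = s * u (x (n + 1)) :=
    fun n ↦ hR _ _ _ (hxR n) (hxR (n + 1))
  have hdvd : ∀ j n, j ≤ n → k ^ j ∣ u (x n) := by
    intro j
    induction j with
    | zero => simp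
    | succ j ih =>
      intro n hn
      obtain ⟨n, rfl⟩ : ∃ n', n = n' + 1 := ⟨n - 1, by omega⟩
      have h1 : k ^ (j + 1) ∣ s * u (x (n + 1)) := by
        rw [← hrec, pow_succ']
        exact mul_dvd_mul_left _ (dvd_add (ih _ (by omega)) (ih _ (by omega)))
      exact (hks.pow_left).dvd_of_dvd_mul_left h1
  obtain ⟨j, hj⟩ : ∃ j : ℕ, B < k ^ j := by
    obtain ⟨j, hj⟩ := pow_unbounded_of_one_lt B hk
    exact ⟨j, hj⟩
  have hzero : ∀ n, j ≤ n → u (x n) = 0 := fun n hn ↦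
    Int.eq_zero_of_abs_lt_dvd (hdvd j n hn) ((hB _ (hxS n)).trans_lt hj)
  have hback : ∀ i, ∀ n, j ≤ n + i → u (x n) = 0 := by
    intro i
    induction i with
    | zero => exact hzero
    | succ i ih =>
      intro n hn
      have h1 := hrec n
      rw [ih (n + 1) (by omega), ih (n + 2) (by omega)] at h1
      rw [zero_add, mul_zero] at h1
      exact (mul_eq_zero.mp h1).resolve_left (by omega)
  exact hback j 0 (by omega)

variable {m a b c : ℤ}

lemma linear_eq_zero (P : ℤ → ℤ → ℤ → Prop) (R : ℤ → ℤ → ℤ → ℤ → ℤ → ℤ → Prop)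
    (p q r : ℤ) {k s : ℤ} (hk : 1 < k) (hks : IsCoprime k s) (hP : ∀ a b c, P a b c → Adm m a b c)
    (step : ∀ a b c, P a b c → ∃ x y z, P x y z ∧ R a b c x y z)
    (hR : ∀ a b c x y z x' y' z', R a b c x y z → R x y z x' y' z' →
      k * ((p * x' + q * y' + r * z') + (p * a + q * b + r * c)) = s * (p * x + q * y + r * z))
    (h : P a b c) : p * a + q * b + r * c = 0 := by
  refine eq_zero_of_recurrence (α := ℤ × ℤ × ℤ) (fun v ↦ P v.1 v.2.1 v.2.2)
    (fun v w ↦ R v.1 v.2.1 v.2.2 w.1 w.2.1 w.2.2)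
    (fun v ↦ p * v.1 + q * v.2.1 + r * v.2.2) (B := (p ^ 2 + q ^ 2 + r ^ 2) * m) hk hks ?_ ?_ ?_
    (v := (a, b, c)) h
  · rintro ⟨a, b, c⟩ hv
    have := (hP _ _ _ hv).norm
    dsimp only at this ⊢
    rw [Int.abs_eq_natAbs]
    refine (Int.natAbs_le_self_sq _).trans ?_
    rw [← this]
    nlinarith [sq_nonneg (p * b - q * a), sq_nonneg (p * c - r * a), sq_nonneg (q * c - r * b)]
  · rintro ⟨a, b, c⟩ hv
    obtain ⟨x, y, z, h1, h2⟩ := step _ _ _ hv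
    exact ⟨(x, y, z), h1, h2⟩
  · rintro ⟨a, b, c⟩ ⟨x, y, z⟩ ⟨x', y', z'⟩ h1 h2
    exact hR _ _ _ _ _ _ _ _ _ h1 h2

/-- If `m ≡ 41 (mod 168)` is not represented, then the vectors of norm `m` in one of the residue
classes below are permuted by a rational rotation, so they lie on its axis. -/
lemma Adm.not_class₁ (h : Adm m a b c) (p₁ : 3 ∣ a + b + c) (p₂ : 3 ∣ a - b + c)
    (q₁ : 7 ∣ a + 2 * b + 3 * c) (q₂ : 7 ∣ a - 2 * b + 3 * c) : False := by
  have step : ∀ a b c, (Adm m a b c ∧ 3 ∣ a + b + c ∧ 3 ∣ a - b + c ∧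
      7 ∣ a + 2 * b + 3 * c ∧ 7 ∣ a - 2 * b + 3 * c) →
      ∃ x y z, (Adm m x y z ∧ 3 ∣ x + y + z ∧ 3 ∣ x - y + z ∧
      7 ∣ x + 2 * y + 3 * z ∧ 7 ∣ x - 2 * y + 3 * z) ∧
      (3 * x = a - 2 * b - 2 * c ∧ 3 * y = 2 * a + 2 * b - c ∧
      3 * z = -2 * a + b - 2 * c) := by
    clear p₁ p₂ q₁ q₂ h
    rintro a b c ⟨h, p₁, p₂, q₁, q₂⟩
    obtain ⟨k, hk, hw⟩ := h.move₃ 1 1 (by clear q₁ q₂; omega)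
    clear p₁ p₂
    rcases hw.other₃ 1 1 (by clear q₁ q₂; omega) with t | t | t
    · exact ⟨_, _, _, ⟨hw.swap.neg_snd, by clear q₁ q₂; omega, by clear q₁ q₂; omega,
      by clear t; omega, by clear t; omega⟩,
      by linarith, by linarith, by linarith⟩
    · exact (hw.not_dvd₃₂ (-1) 1 (by clear q₁ q₂; omega) (by clear t; omega)).elim
    · exact (hw.not_dvd₃₂ (-1) (-1) (by clear q₁ q₂; omega) (by clear t; omega)).elim
  have hb : 0 * a + 1 * b + 0 * c = 0 :=
    linear_eq_zero _ _ 0 1 0 (k := 3) (s := 4) (by norm_num) (by norm_num)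
      (fun _ _ _ h ↦ h.1) step
      (by rintro _ _ _ _ _ _ _ _ _ ⟨_, _, _⟩ ⟨_, _, _⟩; linarith) ⟨h, p₁, p₂, q₁, q₂⟩
  have hc : 2 * a + 0 * b + (-1) * c = 0 :=
    linear_eq_zero _ _ 2 0 (-1) (k := 3) (s := 4) (by norm_num) (by norm_num)
      (fun _ _ _ h ↦ h.1) step
      (by rintro _ _ _ _ _ _ _ _ _ ⟨_, _, _⟩ ⟨_, _, _⟩; linarith) ⟨h, p₁, p₂, q₁, q₂⟩
  obtain ⟨j, hj⟩ : ∃ j, a = 2 * j + 1 := ⟨a / 2, by have := h.odd; omega⟩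
  have hm : m = 5 * (4 * (j * (j + 1)) + 1) := by
    rw [← h.norm, (by omega : b = 0), (by omega : c = 2 * a), hj]; ring
  have := h.mod
  have := Int.even_iff.mp (Int.even_mul_succ_self j)
  clear step hb hc p₁ p₂ q₁ q₂ hj
  omega

lemma Adm.not_class₃ (h : Adm m a b c) (p₁ : 3 ∣ a + b - c) (p₂ : 3 ∣ a - b + c)
    (q₁ : 7 ∣ a + 2 * b + 3 * c) (q₂ : 7 ∣ a - 2 * b - 3 * c) : False := by
  have step : ∀ a b c, (Adm m a b c ∧ 3 ∣ a + b - c ∧ 3 ∣ a - b + c ∧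
      7 ∣ a + 2 * b + 3 * c ∧ 7 ∣ a - 2 * b - 3 * c) →
      ∃ x y z, (Adm m x y z ∧ 3 ∣ x + y - z ∧ 3 ∣ x - y + z ∧
      7 ∣ x + 2 * y + 3 * z ∧ 7 ∣ x - 2 * y - 3 * z) ∧
      (27 * x = 25 * a - 2 * b - 10 * c ∧ 27 * y = 2 * a - 25 * b + 10 * c ∧
      27 * z = 10 * a + 10 * b + 23 * c) := by
    clear p₁ p₂ q₁ q₂ h
    rintro a b c ⟨h, p₁, p₂, q₁, q₂⟩
    obtain ⟨u, rfl⟩ : ∃ u, a = c - b + 3 * u := ⟨(a + b - c) / 3, by clear p₂ q₁ q₂; omega⟩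
    obtain ⟨v, rfl⟩ : ∃ v, c = b + 3 * v := ⟨(c - b) / 3, by clear p₁ q₁ q₂; omega⟩
    clear p₁ p₂
    obtain ⟨k, hk, hw⟩ := h.move₃ 1 (-1) (by clear q₁ q₂; omega)
    obtain rfl : k = u := by clear q₁ q₂; omega
    rcases hw.other₃ 1 (-1) (by clear q₁ q₂; omega) with t | t | t
    rotate_left
    · exact (hw.not_dvd₂₃ (-1) (-1) (by clear q₁ q₂; omega) (by clear t; omega)).elim
    · exact (hw.not_dvd₃₂ (-1) 1 (by clear q₁ q₂; omega) (by clear t; omega)).elim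
    obtain ⟨e, rfl⟩ : ∃ e, k = b + 3 * e := ⟨(k - b) / 3, by clear q₁ q₂; omega⟩
    obtain ⟨l, hl, hx⟩ := hw.move₃ 1 1 (by clear q₁ q₂; omega)
    obtain rfl : l = b + e + 2 * v := by clear q₁ q₂; omega
    rcases hx.other₃ 1 1 (by clear q₁ q₂ t; omega) with t' | t' | t'
    rotate_left
    · exact (hx.not_dvd₃₂ (-1) 1 (by clear q₁ q₂ t; omega) (by clear t t'; omega)).elim
    · exact (hx.not_dvd₂₃ (-1) (-1) (by clear q₁ q₂ t; omega) (by clear t t'; omega)).elim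
    obtain ⟨f, rfl⟩ : ∃ f, e = 3 * f - b - 2 * v := ⟨(e + b + 2 * v) / 3, by clear q₁ q₂; omega⟩
    clear t
    obtain ⟨n, hn, hy⟩ := hx.move₃ 1 (-1) (by clear q₁ q₂; omega)
    obtain rfl : n = 2 * b + 6 * v - 11 * f := by clear q₁ q₂; omega
    rcases hy.other₃ 1 (-1) (by clear q₁ q₂ t'; omega) with t | t | t
    · exact (hy.not_dvd₂₃ 1 1 (by clear q₁ q₂ t'; omega) (by clear t t'; omega)).elim
    · exact (hy.not_dvd₂₃ (-1) (-1) (by clear q₁ q₂ t'; omega) (by clear t t'; omega)).elim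
    clear t'
    exact ⟨_, _, _, ⟨hy.neg_snd.neg_trd, by clear q₁ q₂ hk hl; omega, by clear q₁ q₂ hk hl; omega,
      by clear t; omega, by clear t; omega⟩,
      by linarith, by linarith, by linarith⟩
  have ha : 1 * a + 0 * b + 0 * c = 0 :=
    linear_eq_zero _ _ 1 0 0 (k := 27) (s := 50) (by norm_num) (by norm_num)
      (fun _ _ _ h ↦ h.1) step
      (by rintro _ _ _ _ _ _ _ _ _ ⟨_, _, _⟩ ⟨_, _, _⟩; linarith) ⟨h, p₁, p₂, q₁, q₂⟩
  have := h.odd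
  clear step p₁ p₂ q₁ q₂
  omega

lemma Adm.not_class₁₀ (h : Adm m a b c) (p₁ : 3 ∣ a - b + c) (p₂ : 3 ∣ a - b - c)
    (q₁ : 7 ∣ a - 2 * b - 3 * c) (q₂ : 7 ∣ a - 3 * b + 2 * c) : False := by
  obtain ⟨k, hk, hw⟩ := h.move₃ (-1) 1 (by clear q₁ q₂; omega)
  clear p₁ p₂
  rcases hw.other₃ (-1) 1 (by clear q₁ q₂; omega) with t | t | t
  · exact (hw.not_dvd₂₃ (-1) (-1) (by clear q₁ q₂; omega) (by clear t; omega)).elim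
  · exact (hw.not_dvd₂₃ 1 1 (by clear q₁ q₂; omega) (by clear t; omega)).elim
  exact (hw.not_class₃ (by clear q₁ q₂; omega) (by clear q₁ q₂; omega)
      (by clear t; omega) (by clear t; omega)).elim

lemma Adm.not_class₆ (h : Adm m a b c) (p₁ : 3 ∣ a + b - c) (p₂ : 3 ∣ a - b + c)
    (q₁ : 7 ∣ a - 2 * b - 3 * c) (q₂ : 7 ∣ a - 3 * b - 2 * c) : False := by
  have step : ∀ a b c, (Adm m a b c ∧ 3 ∣ a + b - c ∧ 3 ∣ a - b + c ∧
      7 ∣ a - 2 * b - 3 * c ∧ 7 ∣ a - 3 * b - 2 * c) →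
      ∃ x y z, (Adm m x y z ∧ 3 ∣ x + y - z ∧ 3 ∣ x - y + z ∧
      7 ∣ x - 2 * y - 3 * z ∧ 7 ∣ x - 3 * y - 2 * z) ∧
      (21 * x = -5 * a - 4 * b - 20 * c ∧ 21 * y = -20 * a + 5 * b + 4 * c ∧
      21 * z = -4 * a - 20 * b + 5 * c) := by
    clear p₁ p₂ q₁ q₂ h
    rintro a b c ⟨h, p₁, p₂, q₁, q₂⟩
    obtain ⟨k, hk, hx⟩ := h.move₃ (-1) 1 (by clear q₁ q₂; omega)
    rcases hx.other₃ (-1) 1 (by clear p₁ p₂ q₁ q₂; omega) with t | t | t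
    rotate_left
    · exact (hx.not_dvd₂₃ 1 1 (by clear p₁ p₂ q₁ q₂; omega) (by clear p₁ p₂ t; omega)).elim
    · exact (hx.not_dvd₂₃ 1 (-1) (by clear p₁ p₂ q₁ q₂; omega) (by clear p₁ p₂ t; omega)).elim
    obtain ⟨l, hl, hu⟩ := h.move₂₃ (-1) (-1) (by clear p₁ p₂ hk t; omega)
    obtain ⟨n, hn, hy⟩ := hu.move₃ 1 (-1) (by clear q₁ q₂ hk t; omega)
    rcases hu.other₂₃ 1 1 (by clear p₁ p₂ q₁ q₂ hk hn t; omega) with r | r | r | r | r | r | r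
    rotate_left
    · exact (hu.not_dvd₂₃ 1 (-1) (by clear q₁ q₂ r hk hn t; omega)
        (by clear p₁ p₂ q₁ q₂ hk hn t; omega)).elim
    · exact (hu.not_dvd₂₃ 1 1 (by clear q₁ q₂ r hk hn t; omega)
        (by clear p₁ p₂ q₁ q₂ hk hn t; omega)).elim
    · exact (hy.not_dvd₂₃ (-1) 1 (by clear q₁ q₂ r; omega) (by clear p₁ p₂ q₁ q₂ hk t; omega)).elim
    · exact (hu.neg_snd.neg_trd.not_class₁₀ (by clear q₁ q₂ r hk hn t; omega)
        (by clear q₁ q₂ r hk hn t; omega)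
      (by clear p₁ p₂ q₁ q₂ hk hn t; omega) (by clear p₁ p₂ q₁ q₂ hk hn t; omega)).elim
    · exact (hu.not_dvd₃₂ 1 (-1) (by clear q₁ q₂ r hk hn t; omega)
        (by clear p₁ p₂ q₁ q₂ hk hn t; omega)).elim
    · exact (hu.not_dvd₃₂ 1 1 (by clear q₁ q₂ r hk hn t; omega)
        (by clear p₁ p₂ q₁ q₂ hk hn t; omega)).elim
    exact ⟨_, _, _, ⟨hy.swap.neg_snd.neg_trd, by clear q₁ q₂ r; omega, by clear q₁ q₂ r; omega,
      by clear p₁ p₂ hk t; omega, by clear p₁ p₂ hk t; omega⟩,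
      by linarith, by linarith, by linarith⟩
  have hb : 0 * a + 1 * b + (-1) * c = 0 :=
    linear_eq_zero _ _ 0 1 (-1) (k := 21) (s := 26) (by norm_num) (by norm_num)
      (fun _ _ _ h ↦ h.1) step
      (by rintro _ _ _ _ _ _ _ _ _ ⟨_, _, _⟩ ⟨_, _, _⟩; linarith) ⟨h, p₁, p₂, q₁, q₂⟩
  have hc : 2 * a + (-3) * b + 0 * c = 0 :=
    linear_eq_zero _ _ 2 (-3) 0 (k := 21) (s := 26) (by norm_num) (by norm_num)
      (fun _ _ _ h ↦ h.1) step
      (by rintro _ _ _ _ _ _ _ _ _ ⟨_, _, _⟩ ⟨_, _, _⟩; linarith) ⟨h, p₁, p₂, q₁, q₂⟩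
  clear step p₁ p₂ q₁ q₂
  obtain ⟨j, rfl⟩ : ∃ j, a = 3 * j := ⟨a / 3, by omega⟩
  obtain rfl : b = 2 * j := by omega
  obtain rfl : c = 2 * j := by omega
  exact h.prim j (by rw [← h.norm]; ring)
    ⟨dvd_mul_left _ _, dvd_mul_left _ _, dvd_mul_left _ _⟩

set_option maxHeartbeats 400000 in
lemma Adm.not_class₄ (h : Adm m a b c) (p₁ : 3 ∣ a + b - c) (p₂ : 3 ∣ a - b - c)
    (q₁ : 7 ∣ a + 3 * b - 2 * c) (q₂ : 7 ∣ a - 3 * b - 2 * c) : False := by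
  have step : ∀ a b c, (Adm m a b c ∧ 3 ∣ a + b - c ∧ 3 ∣ a - b - c ∧
      7 ∣ a + 3 * b - 2 * c ∧ 7 ∣ a - 3 * b - 2 * c) →
      ∃ x y z, (Adm m x y z ∧ 3 ∣ x + y - z ∧ 3 ∣ x - y - z ∧
      7 ∣ x + 3 * y - 2 * z ∧ 7 ∣ x - 3 * y - 2 * z) ∧
      (63 * x = -59 * a - 2 * b - 22 * c ∧ 63 * y = 2 * a + 62 * b - 11 * c ∧
      63 * z = -22 * a + 11 * b + 58 * c) := by
    clear p₁ p₂ q₁ q₂ h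
    rintro a b c ⟨h, p₁, p₂, q₁, q₂⟩
    obtain ⟨u, rfl⟩ : ∃ u, a = c - b + 3 * u := ⟨(a + b - c) / 3, by clear p₂ q₁ q₂; omega⟩
    obtain ⟨v, rfl⟩ : ∃ v, b = 3 * v := ⟨b / 3, by clear p₁ q₁ q₂; omega⟩
    clear p₁ p₂
    obtain ⟨k, hk, hr⟩ := h.move₃ 1 (-1) (by clear q₁ q₂; omega)
    obtain rfl : k = u := by clear q₁ q₂; omega
    clear hk
    rcases hr.other₃ 1 (-1) (by clear q₁ q₂; omega) with t | t | t
    · exact (hr.not_dvd₂₃ 1 1 (by clear q₁ q₂; omega) (by clear t; omega)).elim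
    rotate_left
    · exact (hr.not_class₆ (by clear q₁ q₂; omega) (by clear q₁ q₂; omega)
      (by clear t; omega) (by clear t; omega)).elim
    obtain ⟨w, rfl⟩ : ∃ w, k = 3 * w := ⟨k / 3, by clear q₁ q₂; omega⟩
    obtain ⟨l, hl, hrr⟩ := hr.move₃ (-1) (-1) (by clear q₁ q₂; omega)
    obtain rfl : l = w - 2 * v := by clear q₁ q₂; omega
    clear hl t
    rcases hrr.other₃ (-1) (-1) (by clear q₁ q₂; omega) with t | t | t
    · exact (hrr.not_dvd₂₃ (-1) 1 (by clear q₁ q₂; omega) (by clear t; omega)).elim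
    · exact (hrr.not_dvd₃₂ 1 (-1) (by clear q₁ q₂; omega) (by clear t; omega)).elim
    obtain ⟨e, rfl⟩ : ∃ e, v = 2 * c + 2 * w + 3 * e :=
      ⟨(v - 2 * c - 2 * w) / 3, by clear q₁ q₂; omega⟩
    clear t
    obtain ⟨n, hn, hu⟩ := h.move₃₂ 1 (-1) (by clear q₂; omega)
    have hu₁ := hu.other₂₃ (-1) (-1) (by clear q₁ q₂; omega)
    obtain ⟨i, hi, hur⟩ := hu.move₃ 1 (-1) (by clear q₁ q₂ hu₁; omega)
    obtain rfl : i = 3 * w - 2 * n := by clear q₁ q₂ hu₁; omega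
    obtain ⟨j, hj, hz⟩ := hur.move₃ 1 1 (by clear q₁ q₂ hu₁; omega)
    clear hi
    rcases hu₁ with r | r | r | r | r | r | r
    · exact (hu.not_dvd₂₃ 1 (-1) (by clear q₁ q₂ r hj; omega) (by clear q₁ q₂ hj; omega)).elim
    · exact (hu.not_dvd₂₃ (-1) 1 (by clear q₁ q₂ r hj; omega) (by clear q₁ q₂ hj; omega)).elim
    · exact (hu.not_class₃ (by clear q₁ q₂ r hj; omega) (by clear q₁ q₂ r hj; omega)
      (by clear q₁ q₂ hj; omega) (by clear q₁ q₂ hj; omega)).elim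
    rotate_left
    · exact (hu.not_dvd₃₂ (-1) 1 (by clear q₁ q₂ r hj; omega) (by clear q₁ q₂ hj; omega)).elim
    · exact (hu.not_dvd₃₂ 1 (-1) (by clear q₁ q₂ r hj; omega) (by clear q₁ q₂ hj; omega)).elim
    · exact (hu.not_class₆ (by clear q₁ q₂ r hj; omega) (by clear q₁ q₂ r hj; omega)
      (by clear q₁ q₂ hj; omega) (by clear q₁ q₂ hj; omega)).elim
    exact ⟨_, _, _, ⟨hz.swap.neg_snd.neg_trd, by clear q₁ q₂ r; omega, by clear q₁ q₂ r; omega,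
      by clear q₁ q₂; omega, by clear q₁ q₂; omega⟩,
      by linarith, by linarith, by linarith⟩
  have hb : 0 * a + 1 * b + 0 * c = 0 :=
    linear_eq_zero _ _ 0 1 0 (k := 63) (s := 124) (by norm_num) (by norm_num)
      (fun _ _ _ h ↦ h.1) step
      (by rintro _ _ _ _ _ _ _ _ _ ⟨_, _, _⟩ ⟨_, _, _⟩; linarith) ⟨h, p₁, p₂, q₁, q₂⟩
  have hc : 2 * a + 0 * b + (-11) * c = 0 :=
    linear_eq_zero _ _ 2 0 (-11) (k := 63) (s := 124) (by norm_num) (by norm_num)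
      (fun _ _ _ h ↦ h.1) step
      (by rintro _ _ _ _ _ _ _ _ _ ⟨_, _, _⟩ ⟨_, _, _⟩; linarith) ⟨h, p₁, p₂, q₁, q₂⟩
  clear step p₁ p₂ q₁ q₂
  obtain ⟨j, rfl⟩ : ∃ j, a = 11 * (2 * j + 1) := ⟨a / 22, by have := h.odd; omega⟩
  have hm : m = 125 * (4 * (j * (j + 1)) + 1) := by
    rw [← h.norm, (by omega : b = 0), (by omega : c = 2 * (2 * j + 1))]; ring
  have := h.mod
  have := Int.even_iff.mp (Int.even_mul_succ_self j)
  clear hb hc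
  omega

lemma Adm.not_class₁₆ (h : Adm m a b c) (p₁ : 3 ∣ a + b + c) (p₂ : 3 ∣ a + b - c)
    (q₁ : 7 ∣ a + 2 * b - 3 * c) (q₂ : 7 ∣ a + 3 * b - 2 * c) : False := by
  obtain ⟨k, hk, hw⟩ := h.move₃ 1 1 (by clear q₁ q₂; omega)
  clear p₁ p₂
  rcases hw.other₃ 1 1 (by clear q₁ q₂; omega) with t | t | t
  · exact (hw.swap.neg_trd.not_class₄ (by clear q₁ q₂; omega) (by clear q₁ q₂; omega)
      (by clear t; omega) (by clear t; omega)).elim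
  · exact (hw.not_dvd₂₃ (-1) 1 (by clear q₁ q₂; omega) (by clear t; omega)).elim
  · exact (hw.not_dvd₂₃ (-1) (-1) (by clear q₁ q₂; omega) (by clear t; omega)).elim

lemma Adm.not_class₂₅ (h : Adm m a b c) (p₁ : 3 ∣ a + b + c) (p₂ : 3 ∣ a - b - c)
    (q₁ : 7 ∣ a - 2 * b + 3 * c) (q₂ : 7 ∣ a + 3 * b - 2 * c) : False := by
  obtain ⟨k, hk, hw⟩ := h.move₃ 1 1 (by clear q₁ q₂; omega)
  clear p₁ p₂
  rcases hw.other₃ 1 1 (by clear q₁ q₂; omega) with t | t | t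
  · exact (hw.neg_trd.not_class₁₆ (by clear q₁ q₂; omega) (by clear q₁ q₂; omega)
      (by clear t; omega) (by clear t; omega)).elim
  · exact (hw.swap.neg_trd.not_class₁₆ (by clear q₁ q₂; omega) (by clear q₁ q₂; omega)
      (by clear t; omega) (by clear t; omega)).elim
  · exact (hw.not_dvd₂₃ (-1) (-1) (by clear q₁ q₂; omega) (by clear t; omega)).elim

lemma Adm.false_of_dvd (h : Adm m a b c) (q : 7 ∣ a + 2 * b + 3 * c) : False := by
  rcases h.exists_dvd₃ with ⟨p₁, p₂⟩ | ⟨p₁, p₂⟩ | ⟨p₁, p₂⟩ | p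
  · rcases h.other₂₃ 1 1 (by clear p₁ p₂; omega) with r | r | r | r | r | r | r
    · exact (h.swap.neg_trd.not_class₄ (by clear q r; omega) (by clear q r; omega)
      (by clear p₁ p₂; omega) (by clear p₁ p₂; omega)).elim
    · exact (h.not_dvd₂₃ 1 (-1) (by clear q r; omega) (by clear p₁ p₂; omega)).elim
    · exact (h.not_dvd₂₃ 1 1 (by clear q r; omega) (by clear p₁ p₂; omega)).elim
    · exact (h.neg_trd.not_class₁₆ (by clear q r; omega) (by clear q r; omega)
      (by clear p₁ p₂; omega) (by clear p₁ p₂; omega)).elim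
    · exact (h.neg_snd.neg_trd.not_class₁₀ (by clear q r; omega) (by clear q r; omega)
      (by clear p₁ p₂; omega) (by clear p₁ p₂; omega)).elim
    · exact (h.not_dvd₃₂ 1 (-1) (by clear q r; omega) (by clear p₁ p₂; omega)).elim
    · exact (h.not_dvd₃₂ 1 1 (by clear q r; omega) (by clear p₁ p₂; omega)).elim
  · rcases h.other₂₃ 1 1 (by clear p₁ p₂; omega) with r | r | r | r | r | r | r
    · exact (h.not_dvd₂₃ (-1) 1 (by clear q r; omega) (by clear p₁ p₂; omega)).elim
    · exact (h.not_class₁ (by clear q r; omega) (by clear q r; omega)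
      (by clear p₁ p₂; omega) (by clear p₁ p₂; omega)).elim
    · exact (h.not_dvd₂₃ 1 1 (by clear q r; omega) (by clear p₁ p₂; omega)).elim
    · exact (h.swap.neg_trd.not_class₁₆ (by clear q r; omega) (by clear q r; omega)
      (by clear p₁ p₂; omega) (by clear p₁ p₂; omega)).elim
    · exact (h.not_dvd₃₂ (-1) 1 (by clear q r; omega) (by clear p₁ p₂; omega)).elim
    · exact (h.swap.neg_snd.not_class₁₀ (by clear q r; omega) (by clear q r; omega)
      (by clear p₁ p₂; omega) (by clear p₁ p₂; omega)).elim
    · exact (h.not_dvd₃₂ 1 1 (by clear q r; omega) (by clear p₁ p₂; omega)).elim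
  · rcases h.other₂₃ 1 1 (by clear p₁ p₂; omega) with r | r | r | r | r | r | r
    · exact (h.not_dvd₂₃ (-1) 1 (by clear q r; omega) (by clear p₁ p₂; omega)).elim
    · exact (h.not_dvd₂₃ 1 (-1) (by clear q r; omega) (by clear p₁ p₂; omega)).elim
    · exact (h.not_class₃ (by clear q r; omega) (by clear q r; omega)
      (by clear p₁ p₂; omega) (by clear p₁ p₂; omega)).elim
    · exact (h.neg_snd.neg_trd.not_class₆ (by clear q r; omega) (by clear q r; omega)
      (by clear p₁ p₂; omega) (by clear p₁ p₂; omega)).elim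
    · exact (h.not_dvd₃₂ (-1) 1 (by clear q r; omega) (by clear p₁ p₂; omega)).elim
    · exact (h.not_dvd₃₂ 1 (-1) (by clear q r; omega) (by clear p₁ p₂; omega)).elim
    · exact (h.neg_snd.not_class₂₅ (by clear q r; omega) (by clear q r; omega)
      (by clear p₁ p₂; omega) (by clear p₁ p₂; omega)).elim
  · exact h.not_dvd₂₃ (-1) (-1) (by clear q; omega) (by clear p; omega)

lemma Adm.false (h : Adm m a b c) : False := by
  rcases h.exists_dvd₇ with q | q | q | q | q | q | q | q
  · exact h.false_of_dvd q
  · exact h.neg_trd.false_of_dvd (by omega)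
  · exact h.neg_snd.false_of_dvd (by omega)
  · exact h.neg_snd.neg_trd.false_of_dvd (by omega)
  · exact h.swap.false_of_dvd (by omega)
  · exact h.neg_trd.swap.false_of_dvd (by omega)
  · exact h.neg_snd.swap.false_of_dvd (by omega)
  · exact h.neg_snd.neg_trd.swap.false_of_dvd (by omega)

end Descent

section ThreeSquares

lemma exists_abs_two_mul_add_le (d : ℤ) {a : ℤ} (ha : 0 < a) : ∃ k : ℤ, |2 * (d + k * a)| ≤ a := by
  refine ⟨-((2 * d + a) / (2 * a)), ?_⟩
  have h1 := Int.emod_add_mul_ediv (2 * d + a) (2 * a)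
  have h2 := Int.emod_nonneg (2 * d + a) (by omega : 2 * a ≠ 0)
  have h3 := Int.emod_lt_of_pos (2 * d + a) (by omega : 0 < 2 * a)
  rw [abs_le]
  constructor <;> nlinarith

/-- Every positive definite binary form of determinant `D` is equivalent to one whose leading
coefficient `g` satisfies `3g² ≤ 4D`. -/
lemma exists_reduced_binary (D : ℤ) (hD : 0 < D) (N : ℕ) : ∀ A B C : ℤ, 0 < A → A ≤ N →
    A * C - B ^ 2 = D → ∃ p q r s : ℤ, p * s - q * r = 1 ∧
      0 < A * p ^ 2 + 2 * B * p * r + C * r ^ 2 ∧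
      3 * (A * p ^ 2 + 2 * B * p * r + C * r ^ 2) ^ 2 ≤ 4 * D := by
  induction N with
  | zero => intro A _ _ h1 h2; simp at h2; omega
  | succ N ih =>
    intro A B C hA hN hdet
    obtain ⟨k, hk⟩ := exists_abs_two_mul_add_le B hA
    have hdet' : A * (C + 2 * k * B + k ^ 2 * A) - (B + k * A) ^ 2 = D := by rw [← hdet]; ring
    by_cases hC : A ≤ C + 2 * k * B + k ^ 2 * A
    · refine ⟨1, 0, 0, 1, by norm_num, by simpa using hA, ?_⟩
      have h1 := sq_le_sq' (abs_le.mp hk).1 (abs_le.mp hk).2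
      have h2 := mul_le_mul_of_nonneg_left hC hA.le
      simp only [one_pow, mul_one, mul_zero, add_zero, ne_eq, OfNat.ofNat_ne_zero,
        not_false_eq_true, zero_pow]
      nlinarith
    · obtain ⟨p, q, r, s, h1, h2, h3⟩ := ih (C + 2 * k * B + k ^ 2 * A) (-(B + k * A)) A
        (by by_contra! h; nlinarith [mul_nonpos_of_nonneg_of_nonpos hA.le h])
        (by push_cast at hN; omega) (by rw [← hdet']; ring)
      have e : A * (k * p - r) ^ 2 + 2 * B * (k * p - r) * p + C * p ^ 2 =
        (C + 2 * k * B + k ^ 2 * A) * p ^ 2 + 2 * (-(B + k * A)) * p * r + A * r ^ 2 := by ring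
      refine ⟨k * p - r, k * q - s, p, q, by linear_combination h1, ?_, ?_⟩
      · rwa [e]
      · rwa [e]

lemma binary_eq_add_sq {A B C : ℤ} (hA : 0 < A) (hdet : A * C - B ^ 2 = 1) (y z : ℤ) :
    ∃ s t : ℤ, A * y ^ 2 + 2 * B * y * z + C * z ^ 2 = s ^ 2 + t ^ 2 := by
  obtain ⟨p, q, r, s, h1, h2, h3⟩ :=
    exists_reduced_binary 1 one_pos A.toNat A B C hA (by omega) hdet
  set g := A * p ^ 2 + 2 * B * p * r + C * r ^ 2 with hg
  have hg1 : g = 1 := by nlinarith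
  obtain ⟨Y, Z, rfl, rfl⟩ : ∃ Y Z, y = p * Y + q * Z ∧ z = r * Y + s * Z :=
    ⟨s * y - q * z, p * z - r * y, by linear_combination -y * h1, by linear_combination -z * h1⟩
  refine ⟨Y + (A * p * q + B * (p * s + q * r) + C * r * s) * Z, Z, ?_⟩
  have hdet' : (A * p * q + B * (p * s + q * r) + C * r * s) ^ 2 + 1 =
      A * q ^ 2 + 2 * B * q * s + C * s ^ 2 := by
    linear_combination -(p * s - q * r) ^ 2 * hdet - (p * s - q * r + 1) * h1 +
      (A * q ^ 2 + 2 * B * q * s + C * s ^ 2) * (hg.symm.trans hg1)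
  linear_combination Y ^ 2 * (hg.symm.trans hg1) - Z ^ 2 * hdet'

/-- A positive definite ternary form of determinant `1` takes only sums of three squares as
values. -/
lemma ternary_eq_add_sq (N : ℕ) : ∀ a b c d e f : ℤ, 0 < a → a ≤ N → 0 < a * b - d ^ 2 →
    a * b * c + 2 * d * e * f - a * f ^ 2 - b * e ^ 2 - c * d ^ 2 = 1 → ∀ x y z : ℤ,
    ∃ r s t : ℤ, a * x ^ 2 + b * y ^ 2 + c * z ^ 2 + 2 * d * x * y + 2 * e * x * z + 2 * f * y * z =
      r ^ 2 + s ^ 2 + t ^ 2 := by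
  induction N with
  | zero => intro a _ _ _ _ _ h1 h2; simp at h2; omega
  | succ N ih =>
    intro a b c d e f ha hN hab hdet x y z
    by_cases ha1 : a = 1
    · subst ha1
      obtain ⟨s, t, h⟩ := binary_eq_add_sq (A := b - d ^ 2) (B := f - d * e) (C := c - e ^ 2)
        (by linarith) (by rw [← hdet]; ring) y z
      exact ⟨x + d * y + e * z, s, t, by linear_combination h⟩
    obtain ⟨p, q, r, s, h1, h2, h3⟩ := exists_reduced_binary a ha (a * b - d ^ 2).toNat
      (a * b - d ^ 2) (a * f - d * e) (a * c - e ^ 2) hab (by omega)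
      (by linear_combination a * hdet)
    obtain ⟨k, hk⟩ := exists_abs_two_mul_add_le (d * p + e * r) ha
    set g := (a * b - d ^ 2) * p ^ 2 + 2 * (a * f - d * e) * p * r + (a * c - e ^ 2) * r ^ 2 with hg
    set b' := b * p ^ 2 + 2 * f * p * r + c * r ^ 2 + 2 * k * (d * p + e * r) + a * k ^ 2 with hb'
    set d' := d * p + e * r + k * a with hd'
    have hgb : a * b' - d' ^ 2 = g := by rw [hg, hb', hd']; ring
    have hb0 : 0 < b' := by
      by_contra! h
      nlinarith [mul_nonpos_of_nonneg_of_nonpos ha.le h]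
    have hba : b' < a := by
      by_contra! h
      have h4 := sq_le_sq' (abs_le.mp hk).1 (abs_le.mp hk).2
      have h5 := mul_le_mul_of_nonneg_left h ha.le
      have h6 : 3 * a ^ 2 ≤ 4 * g := by nlinarith
      have h7 : 3 * a ≤ 2 * g := by nlinarith [(by omega : 2 ≤ a)]
      nlinarith [(by omega : 2 ≤ a)]
    obtain ⟨X, Y, Z, rfl, rfl, rfl⟩ : ∃ X Y Z, x = X + k * Y ∧ y = p * Y + q * Z ∧
        z = r * Y + s * Z :=
      ⟨x - k * (s * y - q * z), s * y - q * z, p * z - r * y, by ring,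
        by linear_combination -y * h1, by linear_combination -z * h1⟩
    obtain ⟨u, v, w, h⟩ := ih b' a (c * s ^ 2 + 2 * f * q * s + b * q ^ 2) d'
      (k * (d * q + e * s) + b * p * q + f * (p * s + q * r) + c * r * s) (d * q + e * s)
      hb0 (by push_cast at hN; omega) (by linarith)
      (by rw [hb', hd']; linear_combination (p * s - q * r) ^ 2 * hdet + (p * s - q * r + 1) * h1)
      Y X Z
    refine ⟨u, v, w, ?_⟩
    rw [← h, hb', hd']
    ring

lemma exists_prime_dvd_sq_add (m : ℕ) (hm : m % 8 = 1) (hm1 : 1 < m) :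
    ∃ d p : ℕ, d * m = 2 * p + 1 ∧ ∃ x : ℤ, (2 * p : ℤ) ∣ x ^ 2 + d := by
  obtain ⟨p, hp0, hp, hpm⟩ := Nat.forall_exists_prime_gt_and_modEq (3 * m) (q := 4 * m)
    (a := (3 * m - 1) / 2) (by omega) (by
      rw [Nat.coprime_mul_iff_right]
      constructor
      · exact Nat.Coprime.pow_right 2 (Nat.coprime_two_right.mpr (Nat.odd_iff.mpr (by omega)))
      · refine Nat.isCoprime_iff_coprime.mp ⟨-2, 3, ?_⟩
        have : 2 * ((3 * m - 1) / 2) + 1 = 3 * m := by omega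
        zify at this ⊢
        linarith)
  obtain ⟨d, hd, hd8⟩ : ∃ d, d * m = 2 * p + 1 ∧ d % 8 = 3 := by
    obtain ⟨j, hj⟩ := (Nat.modEq_iff_dvd' (by omega)).mp hpm.symm
    refine ⟨8 * j + 3, ?_, by omega⟩
    have : 2 * ((3 * m - 1) / 2) + 1 = 3 * m := by omega
    have : p = 4 * m * j + (3 * m - 1) / 2 := by omega
    rw [add_mul]
    linarith
  have hp4 : p % 4 = 1 := by
    have h : d * m % 8 = 3 := by rw [Nat.mul_mod, hd8, hm]
    omega
  have := Fact.mk hp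
  have hdo : Odd d := Nat.odd_iff.mpr (by omega)
  have hj : jacobiSym (-d) p = 1 := by
    have h1 : jacobiSym (-2) d * jacobiSym p d = 1 := by
      rw [← jacobiSym.mul_left, ← jacobiSym.one_left d]
      apply jacobiSym.mod_left'
      apply Int.ModEq.symm
      rw [Int.modEq_iff_dvd]
      exact ⟨-m, by zify at hd; linarith⟩
    rw [jacobiSym.at_neg_two hdo, ZMod.χ₈'_nat_eq_if_mod_eight, if_neg (by omega),
      if_pos (by omega), one_mul] at h1
    rw [jacobiSym.neg _ (Nat.odd_iff.mpr (by omega)), ZMod.χ₄_nat_one_mod_four hp4, one_mul,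
      ← jacobiSym.quadratic_reciprocity_one_mod_four hp4 hdo, h1]
  refine ⟨d, p, hd, ?_⟩
  obtain ⟨y, hy⟩ := ZMod.isSquare_of_jacobiSym_eq_one hj
  have hpx : ∀ x : ℤ, (x : ZMod p) = y → (p : ℤ) ∣ x ^ 2 + d := by
    intro x hx
    rw [← ZMod.intCast_zmod_eq_zero_iff_dvd]
    push_cast at hy ⊢
    rw [hx, sq, ← hy]; ring
  have h2 : ∃ x : ℤ, (x : ZMod p) = y ∧ x % 2 = 1 := by
    obtain ⟨x, rfl⟩ := ZMod.intCast_surjective y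
    rcases Int.emod_two_eq_zero_or_one x with h | h
    · exact ⟨x + p, by simp, by omega⟩
    · exact ⟨x, rfl, h⟩
  obtain ⟨x, hx, hx2⟩ := h2
  refine ⟨x, IsCoprime.mul_dvd ?_ ?_ (hpx x hx)⟩
  · exact Int.isCoprime_iff_gcd_eq_one.mpr (by
      rw [← Nat.cast_ofNat, Int.gcd_natCast_natCast]
      exact Nat.coprime_two_left.mpr (Nat.odd_iff.mpr (by omega)))
  · obtain ⟨j, rfl⟩ : ∃ j, x = 2 * j + 1 := ⟨x / 2, by omega⟩
    obtain ⟨i, hi⟩ := hdo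
    exact ⟨2 * j ^ 2 + 2 * j + i + 1, by rw [hi]; push_cast; ring⟩

/-- Every `m ≡ 1 (mod 8)` is a sum of three squares. -/
lemma exists_sum_three_sq {m : ℤ} (hm : m % 8 = 1) (hm1 : 1 < m) :
    ∃ a b c : ℤ, a ^ 2 + b ^ 2 + c ^ 2 = m := by
  lift m to ℕ using by omega
  obtain ⟨d, p, hd, x, k, hk⟩ := exists_prime_dvd_sq_add m (by omega) (by omega)
  zify at hd
  have hd0 : (0 : ℤ) < d := by
    rcases Nat.eq_zero_or_pos d with rfl | h
    · push_cast at hd; omega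
    · exact_mod_cast h
  have hk0 : 0 < k := by
    have : 0 < 2 * (p : ℤ) * k := by rw [← hk]; positivity
    exact pos_of_mul_pos_right this (by positivity)
  obtain ⟨r, s, t, h⟩ := ternary_eq_add_sq k.toNat k (2 * p) m x 1 0 hk0 (by omega)
    (by linarith) (by linear_combination hd - m * hk) 0 0 1
  exact ⟨r, s, t, by rw [← h]; ring⟩

end ThreeSquares

section NormSeventeen

/-- Rotating suitable vectors of norm `17` by an integral quaternion of norm `p` gives a vector of
norm `17p²` which is not divisible by `p`. -/
lemma exists_primitive_norm {p : ℕ} (hp : p.Prime) (hp2 : p ≠ 2) : ∃ x y z : ℤ,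
    x ^ 2 + y ^ 2 + z ^ 2 = 17 * (p : ℤ) ^ 2 ∧ ¬((p : ℤ) ∣ x ∧ (p : ℤ) ∣ y ∧ (p : ℤ) ∣ z) := by
  obtain ⟨a, b, c, d, h⟩ := Nat.sum_four_squares p
  zify at h
  generalize (a : ℤ) = a, (b : ℤ) = b, (c : ℤ) = c, (d : ℤ) = d at h
  by_contra! H
  have hrot (x y z : ℤ) (hn : x ^ 2 + y ^ 2 + z ^ 2 = 17) := H
    ((a ^ 2 + b ^ 2 - c ^ 2 - d ^ 2) * x + 2 * (b * c - a * d) * y + 2 * (b * d + a * c) * z)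
    (2 * (b * c + a * d) * x + (a ^ 2 - b ^ 2 + c ^ 2 - d ^ 2) * y + 2 * (c * d - a * b) * z)
    (2 * (b * d - a * c) * x + 2 * (c * d + a * b) * y + (a ^ 2 - b ^ 2 - c ^ 2 + d ^ 2) * z)
    (by rw [← hn, ← h]; ring)
  have hp' : Prime (p : ℤ) := Nat.prime_iff_prime_int.mp hp
  have hodd : ¬(p : ℤ) ∣ 2 := fun h' ↦
    hp2 ((Nat.prime_dvd_prime_iff_eq hp Nat.prime_two).mp (by exact_mod_cast h'))
  have cancel₂ {x : ℤ} (hx : (p : ℤ) ∣ 2 * x) : (p : ℤ) ∣ x := (hp'.dvd_or_dvd hx).resolve_left hodd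
  have h₁ : (p : ℤ) ∣ a ^ 2 + b ^ 2 - c ^ 2 - d ^ 2 := by
    obtain ⟨i, hi⟩ := (hrot 1 0 4 rfl).1
    obtain ⟨j, hj⟩ := (hrot (-1) 0 4 rfl).1
    exact cancel₂ ⟨i - j, by linear_combination hi - hj⟩
  have h₂ : (p : ℤ) ∣ a ^ 2 - b ^ 2 + c ^ 2 - d ^ 2 := by
    obtain ⟨i, hi⟩ := (hrot 0 1 4 rfl).2.1
    obtain ⟨j, hj⟩ := (hrot 0 (-1) 4 rfl).2.1
    exact cancel₂ ⟨i - j, by linear_combination hi - hj⟩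
  have h₃ : (p : ℤ) ∣ a ^ 2 - b ^ 2 - c ^ 2 + d ^ 2 := by
    obtain ⟨i, hi⟩ := (hrot 0 4 1 rfl).2.2
    obtain ⟨j, hj⟩ := (hrot 0 4 (-1) rfl).2.2
    exact cancel₂ ⟨i - j, by linear_combination hi - hj⟩
  have cancel₄ {x y : ℤ} (hx : 4 * x ^ 2 = y) (hy : (p : ℤ) ∣ y) : (p : ℤ) ∣ x :=
    hp'.dvd_of_dvd_pow (cancel₂ (cancel₂ (by rw [← mul_assoc]; exact hx ▸ hy)))
  have hp₀ := dvd_refl (p : ℤ)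
  obtain ⟨a, rfl⟩ := cancel₄ (x := a) (by linear_combination h)
    (dvd_add (dvd_add (dvd_add hp₀ h₁) h₂) h₃)
  obtain ⟨b, rfl⟩ := cancel₄ (x := b) (by linear_combination h)
    (dvd_sub (dvd_sub (dvd_add hp₀ h₁) h₂) h₃)
  obtain ⟨c, rfl⟩ := cancel₄ (x := c) (by linear_combination h)
    (dvd_sub (dvd_sub (dvd_add hp₀ h₂) h₁) h₃)
  obtain ⟨d, rfl⟩ := cancel₄ (x := d) (by linear_combination h)
    (dvd_sub (dvd_sub (dvd_add hp₀ h₃) h₁) h₂)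
  refine hp'.not_isUnit (.of_mul_eq_one (a ^ 2 + b ^ 2 + c ^ 2 + d ^ 2) ?_)
  apply mul_left_cancel₀ hp'.ne_zero
  linear_combination h

end NormSeventeen

lemma exists_norm_of_eq_seventeen_mul_sq {t : ℤ} (ht : t % 2 = 1) (ht1 : ¬IsUnit t) :
    ∃ a b c : ℤ, a ^ 2 + b ^ 2 + c ^ 2 = 17 * t ^ 2 ∧ ¬(t ∣ a ∧ t ∣ b ∧ t ∣ c) := by
  obtain ⟨p, hp, hpt⟩ := Nat.exists_prime_and_dvd (fun h ↦ ht1 (Int.isUnit_iff_natAbs_eq.mpr h))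
  obtain ⟨s, rfl⟩ := Int.natCast_dvd.mpr hpt
  have hp2 : p ≠ 2 := by rintro rfl; push_cast at ht; omega
  obtain ⟨x, y, z, h, hxyz⟩ := exists_primitive_norm hp hp2
  have hs : s ≠ 0 := by rintro rfl; simp at ht
  refine ⟨x * s, y * s, z * s, by linear_combination s ^ 2 * h, ?_⟩
  simpa only [mul_dvd_mul_iff_right hs] using hxyz

lemma exists_adm_of_norm {m a b c : ℤ} (hrep : ¬IsRep m) (hm : m % 168 = 41)
    (hn : a ^ 2 + b ^ 2 + c ^ 2 = m) (hprim : ∀ t, m = 17 * t ^ 2 → ¬(t ∣ a ∧ t ∣ b ∧ t ∣ c)) :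
    ∃ a b c, Adm m a b c := by
  have sq_mod (x : ℤ) : x % 2 = 0 ∧ x ^ 2 % 4 = 0 ∨ x % 2 = 1 ∧ x ^ 2 % 4 = 1 := by
    rcases Int.even_or_odd' x with ⟨k, rfl | rfl⟩
    · exact .inl ⟨by omega, by ring_nf; omega⟩
    · exact .inr ⟨by omega, by ring_nf; omega⟩
  rcases sq_mod a with ⟨ha, ha'⟩ | ⟨ha, ha'⟩ <;> rcases sq_mod b with ⟨hb, hb'⟩ | ⟨hb, hb'⟩ <;>
    rcases sq_mod c with ⟨hc, hc'⟩ | ⟨hc, hc'⟩ <;> try omega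
  · exact ⟨c, a, b, hrep, hm, by linarith, hc, ha, hb, fun t ht h ↦ hprim t ht (by tauto)⟩
  · exact ⟨b, a, c, hrep, hm, by linarith, hb, ha, hc, fun t ht h ↦ hprim t ht (by tauto)⟩
  · exact ⟨a, b, c, hrep, hm, hn, ha, hb, hc, hprim⟩

lemma isRep_of_mod {m : ℤ} (hm : m % 168 = 41) (hm0 : 0 < m) : IsRep m := by
  by_contra hrep
  obtain ⟨a, b, c, hn, hprim⟩ : ∃ a b c : ℤ, a ^ 2 + b ^ 2 + c ^ 2 = m ∧
      ∀ t, m = 17 * t ^ 2 → ¬(t ∣ a ∧ t ∣ b ∧ t ∣ c) := by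
    by_cases h : ∃ t, m = 17 * t ^ 2
    · obtain ⟨t, rfl⟩ := h
      have ht : t % 2 = 1 := by
        rcases Int.even_or_odd' t with ⟨k, rfl | rfl⟩ <;> ring_nf at hm <;> omega
      have ht1 : ¬IsUnit t := fun h ↦ by
        rw [Int.isUnit_sq h] at hm
        omega
      obtain ⟨a, b, c, hn, hprim⟩ := exists_norm_of_eq_seventeen_mul_sq ht ht1
      refine ⟨a, b, c, hn, fun u hu ↦ ?_⟩
      rcases sq_eq_sq_iff_eq_or_eq_neg.mp (by linarith : u ^ 2 = t ^ 2) with rfl | rfl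
      · exact hprim
      · simpa only [neg_dvd] using hprim
    · obtain ⟨a, b, c, hn⟩ := exists_sum_three_sq (by omega : m % 8 = 1) (by omega)
      exact ⟨a, b, c, hn, fun t ht ↦ absurd ⟨t, ht⟩ h⟩
  obtain ⟨a, b, c, h⟩ := exists_adm_of_norm hrep hm hn hprim
  exact h.false

/-- The ternary sum `x(2x+1) + y(3y+1) + z(7z+1)` is universal: for every
non negative integer `n`, the equation `x(2x+1) + y(3y+1) + z(7z+1) = n`
has an integer solution `x, y, z`. -/
theorem universal_2_3_7 (n : ℤ) (hn : 0 ≤ n) :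
    ∃ x y z : ℤ, x * (2 * x + 1) + y * (3 * y + 1) + z * (7 * z + 1) = n :=
  universal_of_isRep (isRep_of_mod (by omega) (by omega))
end
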